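/- Let (g,c,n) be a v-admissible triplet. If either g = c, or g < c and n ≥ c - 1 + g/4, then B(g,c,n) = c/4. -/

import Mathlib

open SimpleGraph Set

/-- Auxiliary distance on representations of points of the metric graph:
a point is represented by `(u, v, t)` with `u, v` adjacent and `t ∈ [0,1]`,
meaning the point on the edge `[u,v]` at distance `t` from `u`. -/
noncomputable def mgDistAux {V : Type} [Fintype V] [DecidableEq V] (G : SimpleGraph V)
    (p q : V × V × ℝ) : ℝ :=
  min
    (min (if p.1 = q.1 ∧ p.2.1 = q.2.1 then |p.2.2 - q.2.2| else (Fintype.card V : ℝ) + 1)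
         (if p.1 = q.2.1 ∧ p.2.1 = q.1 then |p.2.2 - (1 - q.2.2)| else (Fintype.card V : ℝ) + 1))
    (min (min (p.2.2 + (G.dist p.1 q.1 : ℝ) + q.2.2)
              (p.2.2 + (G.dist p.1 q.2.1 : ℝ) + (1 - q.2.2)))
         (min ((1 - p.2.2) + (G.dist p.2.1 q.1 : ℝ) + q.2.2)
              ((1 - p.2.2) + (G.dist p.2.1 q.2.1 : ℝ) + (1 - q.2.2))))

/-- The points of the metric graph associated to a simple graph `G`:
the vertices together with the interior points of the edges. -/
def MGPoint {V : Type} (G : SimpleGraph V) : Type :=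
  {p : V × V × ℝ // G.Adj p.1 p.2.1 ∧ p.2.2 ∈ Set.Icc (0 : ℝ) 1}

/-- The shortest-path distance on the metric graph associated to `G`
(every edge has length 1). -/
noncomputable def mgDist {V : Type} [Fintype V] [DecidableEq V] (G : SimpleGraph V)
    (p q : MGPoint G) : ℝ := mgDistAux G p.1 q.1

/-- Distance from a vertex `v` to a point of the metric graph. -/
noncomputable def mgVDist {V : Type} [Fintype V] [DecidableEq V] (G : SimpleGraph V)
    (v : V) (x : MGPoint G) : ℝ :=
  min ((G.dist v x.1.1 : ℝ) + x.1.2.2) ((G.dist v x.1.2.1 : ℝ) + (1 - x.1.2.2))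

/-- `γ` restricted to `[a,b]` is a geodesic in the metric graph of `G`
(an arc-length parametrization realizing distances). -/
def IsMGGeodesic {V : Type} [Fintype V] [DecidableEq V] (G : SimpleGraph V)
    (a b : ℝ) (γ : ℝ → MGPoint G) : Prop :=
  a ≤ b ∧ ∀ s ∈ Set.Icc a b, ∀ t ∈ Set.Icc a b, mgDist G (γ s) (γ t) = |s - t|

/-- A geodesic triangle in the metric graph of `G`: three geodesic sides whose
endpoints match cyclically (distance `0` means equality of points). -/
structure MGTriangle {V : Type} [Fintype V] [DecidableEq V] (G : SimpleGraph V) where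
  a1 : ℝ
  b1 : ℝ
  a2 : ℝ
  b2 : ℝ
  a3 : ℝ
  b3 : ℝ
  g1 : ℝ → MGPoint G
  g2 : ℝ → MGPoint G
  g3 : ℝ → MGPoint G
  h1 : IsMGGeodesic G a1 b1 g1
  h2 : IsMGGeodesic G a2 b2 g2
  h3 : IsMGGeodesic G a3 b3 g3
  glue1 : mgDist G (g1 b1) (g2 a2) = 0
  glue2 : mgDist G (g2 b2) (g3 a3) = 0
  glue3 : mgDist G (g3 b3) (g1 a1) = 0

/-- The sharp thin constant `δ(T)` of a geodesic triangle: the infimum of the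
`d ≥ 0` such that each side is contained in the `d`-neighborhood of the union of
the other two sides. -/
noncomputable def triangleDelta {V : Type} [Fintype V] [DecidableEq V] {G : SimpleGraph V}
    (T : MGTriangle G) : ℝ :=
  sInf {d : ℝ | 0 ≤ d ∧
    (∀ s ∈ Set.Icc T.a1 T.b1,
      (∃ t ∈ Set.Icc T.a2 T.b2, mgDist G (T.g1 s) (T.g2 t) ≤ d) ∨
      (∃ t ∈ Set.Icc T.a3 T.b3, mgDist G (T.g1 s) (T.g3 t) ≤ d)) ∧
    (∀ s ∈ Set.Icc T.a2 T.b2,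
      (∃ t ∈ Set.Icc T.a1 T.b1, mgDist G (T.g2 s) (T.g1 t) ≤ d) ∨
      (∃ t ∈ Set.Icc T.a3 T.b3, mgDist G (T.g2 s) (T.g3 t) ≤ d)) ∧
    (∀ s ∈ Set.Icc T.a3 T.b3,
      (∃ t ∈ Set.Icc T.a1 T.b1, mgDist G (T.g3 s) (T.g1 t) ≤ d) ∨
      (∃ t ∈ Set.Icc T.a2 T.b2, mgDist G (T.g3 s) (T.g2 t) ≤ d))}

/-- The hyperbolicity constant `δ(G)`: the supremum of `δ(T)` over all geodesic
triangles `T` in the metric graph of `G`. -/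
noncomputable def hypDelta {V : Type} [Fintype V] [DecidableEq V] (G : SimpleGraph V) : ℝ :=
  sSup {d : ℝ | ∃ T : MGTriangle G, d = triangleDelta T}

/-- The circumference of `G`: the length of a longest cycle. -/
noncomputable def circumference {V : Type} (G : SimpleGraph V) : ℕ :=
  sSup {n : ℕ | ∃ (a : V) (w : G.Walk a a), w.IsCycle ∧ w.length = n}

/-- `G` belongs to the class `𝒢(g,c,n)` of (connected) graphs with girth `g`,
circumference `c` and `n` vertices (vertex set `Fin n`). -/
def memGclass (g c : ℕ) {n : ℕ} (G : SimpleGraph (Fin n)) : Prop :=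
  G.Connected ∧ G.girth = g ∧ circumference G = c

/-- `A(g,c,n) = min {δ(G) : G ∈ 𝒢(g,c,n)}`. -/
noncomputable def Agcn (g c n : ℕ) : ℝ :=
  sInf {d : ℝ | ∃ G : SimpleGraph (Fin n), memGclass g c G ∧ d = hypDelta G}

/-- `B(g,c,n) = max {δ(G) : G ∈ 𝒢(g,c,n)}`. -/
noncomputable def Bgcn (g c n : ℕ) : ℝ :=
  sSup {d : ℝ | ∃ G : SimpleGraph (Fin n), memGclass g c G ∧ d = hypDelta G}

/-- `G` belongs to the class `ℋ(g,c,m)` of (connected) graphs with girth `g`,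
circumference `c` and `m` edges. -/
def memHclass (g c m : ℕ) {k : ℕ} (G : SimpleGraph (Fin k)) : Prop :=
  G.Connected ∧ G.girth = g ∧ circumference G = c ∧ G.edgeSet.ncard = m

/-- `α(g,c,m) = min {δ(G) : G ∈ ℋ(g,c,m)}`. -/
noncomputable def alphagcm (g c m : ℕ) : ℝ :=
  sInf {d : ℝ | ∃ (k : ℕ) (G : SimpleGraph (Fin k)), memHclass g c m G ∧ d = hypDelta G}

/-- `β(g,c,m) = max {δ(G) : G ∈ ℋ(g,c,m)}`. -/
noncomputable def betagcm (g c m : ℕ) : ℝ :=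
  sSup {d : ℝ | ∃ (k : ℕ) (G : SimpleGraph (Fin k)), memHclass g c m G ∧ d = hypDelta G}

section MG
set_option linter.unusedSectionVars false
variable {V : Type} [Fintype V] [DecidableEq V] {G : SimpleGraph V}

/-- `P` lies on the edge `[e,o]` at distance `τ` from `e` (either orientation of the
representation is allowed). -/
def OnEdge (G : SimpleGraph V) (P : MGPoint G) (e o : V) (τ : ℝ) : Prop :=
  (P.1.1 = e ∧ P.1.2.1 = o ∧ P.1.2.2 = τ) ∨ (P.1.1 = o ∧ P.1.2.1 = e ∧ P.1.2.2 = 1 - τ)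

theorem OnEdge.flip {P : MGPoint G} {e o : V} {τ : ℝ} (h : OnEdge G P e o τ) :
    OnEdge G P o e (1 - τ) := by
  rcases h with ⟨h1, h2, h3⟩ | ⟨h1, h2, h3⟩
  · right; refine ⟨h1, h2, by linarith⟩
  · left; exact ⟨h1, h2, h3⟩

theorem OnEdge.self (P : MGPoint G) : OnEdge G P P.1.1 P.1.2.1 P.1.2.2 :=
  Or.inl ⟨rfl, rfl, rfl⟩

theorem OnEdge.adj {P : MGPoint G} {e o : V} {τ : ℝ} (h : OnEdge G P e o τ) : G.Adj e o := by
  have := P.2.1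
  rcases h with ⟨h1, h2, h3⟩ | ⟨h1, h2, h3⟩
  · rwa [h1, h2] at this
  · rw [h1, h2] at this; exact this.symm

theorem OnEdge.nonneg {P : MGPoint G} {e o : V} {τ : ℝ} (h : OnEdge G P e o τ) : 0 ≤ τ := by
  have := P.2.2.1
  have h' := P.2.2.2
  rcases h with ⟨h1, h2, h3⟩ | ⟨h1, h2, h3⟩ <;> linarith

theorem OnEdge.le_one {P : MGPoint G} {e o : V} {τ : ℝ} (h : OnEdge G P e o τ) : τ ≤ 1 := by
  have := h.flip.nonneg
  linarith

/-- Two descriptions of a point as a point on an edge agree up to orientation. -/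
theorem OnEdge.unique {P : MGPoint G} {e o e' o' : V} {τ τ' : ℝ} (h : OnEdge G P e o τ)
    (h' : OnEdge G P e' o' τ') :
    (e = e' ∧ o = o' ∧ τ = τ') ∨ (e = o' ∧ o = e' ∧ τ = 1 - τ') := by
  rcases h with ⟨h1, h2, h3⟩ | ⟨h1, h2, h3⟩ <;> rcases h' with ⟨k1, k2, k3⟩ | ⟨k1, k2, k3⟩
  · left; exact ⟨h1 ▸ k1, h2 ▸ k2, by linarith⟩
  · right; exact ⟨h1 ▸ k1, h2 ▸ k2, by linarith⟩
  · right; exact ⟨h2 ▸ k2, h1 ▸ k1, by linarith⟩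
  · left; exact ⟨h2 ▸ k2, h1 ▸ k1, by linarith⟩

theorem mgDist_le_via {P Q : MGPoint G} {e o e' o' : V} {τ τ' : ℝ} (h : OnEdge G P e o τ)
    (h' : OnEdge G Q e' o' τ') : mgDist G P Q ≤ τ + (G.dist e e' : ℝ) + τ' := by
  unfold mgDist mgDistAux
  rcases h with ⟨h1, h2, h3⟩ | ⟨h1, h2, h3⟩ <;> rcases h' with ⟨k1, k2, k3⟩ | ⟨k1, k2, k3⟩ <;>
    rw [h1, h2, h3, k1, k2, k3] <;> simp

theorem mgDist_le_same {P Q : MGPoint G} {e o : V} {τ τ' : ℝ} (h : OnEdge G P e o τ)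
    (h' : OnEdge G Q e o τ') : mgDist G P Q ≤ |τ - τ'| := by
  unfold mgDist mgDistAux
  rcases h with ⟨h1, h2, h3⟩ | ⟨h1, h2, h3⟩ <;> rcases h' with ⟨k1, k2, k3⟩ | ⟨k1, k2, k3⟩ <;>
    rw [h1, h2, h3, k1, k2, k3] <;> simp [abs_sub_comm τ' τ]

theorem mgDist_cases' (P Q : MGPoint G) :
    (∃ e o τ e' o' τ', OnEdge G P e o τ ∧ OnEdge G Q e' o' τ' ∧
      mgDist G P Q = τ + (G.dist e e' : ℝ) + τ') ∨
    (∃ e o τ τ', OnEdge G P e o τ ∧ OnEdge G Q e o τ' ∧ mgDist G P Q = |τ - τ'|) ∨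
    mgDist G P Q = (Fintype.card V : ℝ) + 1 := by
  have hP := OnEdge.self P
  have hQ := OnEdge.self Q
  have hP' := hP.flip
  have hQ' := hQ.flip
  unfold mgDist mgDistAux
  set A := (if P.1.1 = Q.1.1 ∧ P.1.2.1 = Q.1.2.1 then |P.1.2.2 - Q.1.2.2|
    else (Fintype.card V : ℝ) + 1) with hA
  set B := (if P.1.1 = Q.1.2.1 ∧ P.1.2.1 = Q.1.1 then |P.1.2.2 - (1 - Q.1.2.2)|
    else (Fintype.card V : ℝ) + 1) with hB
  rcases min_choice (min A B) (min (min (P.1.2.2 + (G.dist P.1.1 Q.1.1 : ℝ) + Q.1.2.2)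
              (P.1.2.2 + (G.dist P.1.1 Q.1.2.1 : ℝ) + (1 - Q.1.2.2)))
         (min ((1 - P.1.2.2) + (G.dist P.1.2.1 Q.1.1 : ℝ) + Q.1.2.2)
              ((1 - P.1.2.2) + (G.dist P.1.2.1 Q.1.2.1 : ℝ) + (1 - Q.1.2.2)))) with h | h
  · rw [h]
    right
    rcases min_choice A B with h | h
    · rw [h, hA]
      split_ifs with hc
      · left
        refine ⟨_, _, _, _, hP, ?_, rfl⟩
        rw [hc.1, hc.2]; exact hQ
      · right; rfl
    · rw [h, hB]
      split_ifs with hc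
      · left
        refine ⟨_, _, _, _, hP, ?_, rfl⟩
        rw [hc.1, hc.2]; exact hQ'
      · right; rfl
  · rw [h]
    left
    rcases min_choice (min (P.1.2.2 + (G.dist P.1.1 Q.1.1 : ℝ) + Q.1.2.2)
              (P.1.2.2 + (G.dist P.1.1 Q.1.2.1 : ℝ) + (1 - Q.1.2.2)))
         (min ((1 - P.1.2.2) + (G.dist P.1.2.1 Q.1.1 : ℝ) + Q.1.2.2)
              ((1 - P.1.2.2) + (G.dist P.1.2.1 Q.1.2.1 : ℝ) + (1 - Q.1.2.2))) with h | h <;> rw [h]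
    · rcases min_choice (P.1.2.2 + (G.dist P.1.1 Q.1.1 : ℝ) + Q.1.2.2)
              (P.1.2.2 + (G.dist P.1.1 Q.1.2.1 : ℝ) + (1 - Q.1.2.2)) with h | h <;> rw [h]
      · exact ⟨_, _, _, _, _, _, hP, hQ, rfl⟩
      · exact ⟨_, _, _, _, _, _, hP, hQ', rfl⟩
    · rcases min_choice ((1 - P.1.2.2) + (G.dist P.1.2.1 Q.1.1 : ℝ) + Q.1.2.2)
              ((1 - P.1.2.2) + (G.dist P.1.2.1 Q.1.2.1 : ℝ) + (1 - Q.1.2.2)) with h | h <;> rw [h]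
      · exact ⟨_, _, _, _, _, _, hP', hQ, rfl⟩
      · exact ⟨_, _, _, _, _, _, hP', hQ', rfl⟩

theorem dist_lt_card (hG : G.Connected) (u v : V) : G.dist u v < Fintype.card V := by
  obtain ⟨p, hp, hl⟩ := hG.exists_path_of_dist u v
  rw [← hl]
  exact hp.length_lt

theorem mgDist_lt_card (hG : G.Connected) (P Q : MGPoint G) :
    mgDist G P Q < (Fintype.card V : ℝ) + 1 := by
  have hP := OnEdge.self P
  have hQ := OnEdge.self Q
  have h1 := mgDist_le_via hP hQ
  have h2 := mgDist_le_via hP.flip hQ.flip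
  have d1 : ((G.dist P.1.1 Q.1.1 : ℕ) : ℝ) + 1 ≤ Fintype.card V := by
    exact_mod_cast dist_lt_card hG P.1.1 Q.1.1
  have d2 : ((G.dist P.1.2.1 Q.1.2.1 : ℕ) : ℝ) + 1 ≤ Fintype.card V := by
    exact_mod_cast dist_lt_card hG P.1.2.1 Q.1.2.1
  linarith

/-- The distance between two points is realized through endpoints of edges, or inside an edge. -/
theorem mgDist_cases (hG : G.Connected) (P Q : MGPoint G) :
    (∃ e o τ e' o' τ', OnEdge G P e o τ ∧ OnEdge G Q e' o' τ' ∧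
      mgDist G P Q = τ + (G.dist e e' : ℝ) + τ') ∨
    (∃ e o τ τ', OnEdge G P e o τ ∧ OnEdge G Q e o τ' ∧ mgDist G P Q = |τ - τ'|) := by
  rcases mgDist_cases' P Q with h | h | h
  · exact Or.inl h
  · exact Or.inr h
  · exact absurd h (mgDist_lt_card hG P Q).ne

theorem mgDist_nonneg (hG : G.Connected) (P Q : MGPoint G) : 0 ≤ mgDist G P Q := by
  rcases mgDist_cases hG P Q with ⟨e, o, τ, e', o', τ', h, h', hd⟩ | ⟨e, o, τ, τ', h, h', hd⟩
  · rw [hd]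
    have := h.nonneg
    have := h'.nonneg
    positivity
  · rw [hd]; positivity

theorem mgDist_triangle (hG : G.Connected) (P Q R : MGPoint G) :
    mgDist G P R ≤ mgDist G P Q + mgDist G Q R := by
  have tri : ∀ u v w : V, (G.dist u w : ℝ) ≤ G.dist u v + G.dist v w := by
    intro u v w
    exact_mod_cast hG.dist_triangle
  have adj : ∀ u v : V, G.Adj u v → (G.dist u v : ℝ) = 1 := by
    intro u v h
    rw [SimpleGraph.dist_eq_one_iff_adj.mpr h]; simp
  have key : ∀ {e o e' o' : V} {τ τ' : ℝ}, OnEdge G P e o τ → OnEdge G R e' o' τ' →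
      ∀ x : V, ∀ y : V, mgDist G P R ≤ τ + G.dist e x + G.dist x y + G.dist y e' + τ' := by
    intro e o e' o' τ τ' h h' x y
    have := mgDist_le_via h h'
    have := tri e x e'
    have := tri x y e'
    linarith
  rcases mgDist_cases hG P Q with ⟨e, o, τ, e', o', τ', h, h', hd⟩ | ⟨e, o, τ, τ', h, h', hd⟩ <;>
  rcases mgDist_cases hG Q R with ⟨f, q, σ, f', q', σ', k, k', kd⟩ | ⟨f, q, σ, σ', k, k', kd⟩ <;>
  rcases h'.unique k with ⟨rfl, rfl, hs⟩ | ⟨rfl, rfl, hs⟩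
  · have := key h k' e' e'
    simp only [SimpleGraph.dist_self] at this
    have := h'.nonneg
    push_cast at *
    linarith
  · have := key h k' e' o'
    rw [adj _ _ h'.adj] at this
    linarith
  · have := mgDist_le_via h k'
    rw [hd, kd, hs]
    have := neg_abs_le (σ - σ')
    linarith
  · have := mgDist_le_via h k'.flip
    rw [hd, kd, hs]
    have := le_abs_self (σ - σ')
    linarith
  · have := mgDist_le_via h k'
    rw [hd, kd, ← hs]
    have := le_abs_self (τ - τ')
    linarith
  · have := mgDist_le_via h.flip k'
    rw [hd, kd]
    have := neg_abs_le (τ - τ')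
    linarith
  · have := mgDist_le_same h k'
    rw [hd, kd, ← hs]
    have := abs_sub_le τ τ' σ'
    linarith
  · have := mgDist_le_same h k'.flip
    rw [hd, kd]
    have := abs_sub_le τ τ' (1 - σ')
    have e : |σ - σ'| = |τ' - (1 - σ')| := by
      rw [hs, ← abs_neg]; congr 1; ring
    rw [e]; linarith

end MG

section MG2
set_option linter.unusedSectionVars false
variable {V : Type} [Fintype V] [DecidableEq V] {G : SimpleGraph V}

theorem mgDist_comm_le (hG : G.Connected) (P Q : MGPoint G) : mgDist G P Q ≤ mgDist G Q P := by
  rcases mgDist_cases hG Q P with ⟨e, o, τ, e', o', τ', h, h', hd⟩ | ⟨e, o, τ, τ', h, h', hd⟩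
  · rw [hd]
    have := mgDist_le_via h' h
    rw [G.dist_comm] at this
    linarith
  · rw [hd, abs_sub_comm]
    exact mgDist_le_same h' h

theorem mgDist_comm (hG : G.Connected) (P Q : MGPoint G) : mgDist G P Q = mgDist G Q P :=
  le_antisymm (mgDist_comm_le hG P Q) (mgDist_comm_le hG Q P)

theorem mgDist_self (hG : G.Connected) (P : MGPoint G) : mgDist G P P = 0 := by
  apply le_antisymm _ (mgDist_nonneg hG P P)
  have := mgDist_le_same (OnEdge.self P) (OnEdge.self P)
  simpa using this

theorem mgVDist_le {P : MGPoint G} {e o : V} {τ : ℝ} (h : OnEdge G P e o τ) (v : V) :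
    mgVDist G v P ≤ G.dist v e + τ := by
  unfold mgVDist
  rcases h with ⟨h1, h2, h3⟩ | ⟨h1, h2, h3⟩ <;> rw [h1, h2, h3] <;> simp

theorem mgVDist_cases (P : MGPoint G) (v : V) :
    ∃ e o τ, OnEdge G P e o τ ∧ mgVDist G v P = G.dist v e + τ := by
  unfold mgVDist
  rcases min_choice ((G.dist v P.1.1 : ℝ) + P.1.2.2) ((G.dist v P.1.2.1 : ℝ) + (1 - P.1.2.2))
    with h | h
  · exact ⟨_, _, _, OnEdge.self P, h⟩
  · exact ⟨_, _, _, (OnEdge.self P).flip, h⟩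

theorem mgDist_le_mgVDist (P : MGPoint G) {Q : MGPoint G} {e o : V} {τ : ℝ}
    (h : OnEdge G Q e o τ) : mgDist G P Q ≤ mgVDist G e P + τ := by
  obtain ⟨e', o', τ', h', hd⟩ := mgVDist_cases P e
  have := mgDist_le_via h' h
  rw [hd, G.dist_comm]; linarith

/-- A walk all of whose vertices lie in `S`. -/
def WJoined (G : SimpleGraph V) (S : Set V) (u v : V) : Prop :=
  ∃ w : G.Walk u v, ∀ z ∈ w.support, z ∈ S

theorem WJoined.refl {S : Set V} {u : V} (h : u ∈ S) : WJoined G S u u :=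
  ⟨Walk.nil, by simpa using h⟩

theorem WJoined.symm {S : Set V} {u v : V} (h : WJoined G S u v) : WJoined G S v u := by
  obtain ⟨w, hw⟩ := h
  exact ⟨w.reverse, by simpa using hw⟩

theorem WJoined.trans {S : Set V} {u v x : V} (h : WJoined G S u v) (h' : WJoined G S v x) :
    WJoined G S u x := by
  obtain ⟨w, hw⟩ := h
  obtain ⟨w', hw'⟩ := h'
  refine ⟨w.append w', fun z hz => ?_⟩
  rcases (Walk.mem_support_append_iff _ _).1 hz with hz | hz
  · exact hw z hz
  · exact hw' z hz

theorem WJoined.adj {S : Set V} {u v : V} (h : G.Adj u v) (hu : u ∈ S) (hv : v ∈ S) :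
    WJoined G S u v := by
  refine ⟨Walk.cons h Walk.nil, fun z hz => ?_⟩
  simp at hz
  rcases hz with rfl | rfl <;> assumption

/-- Two edges crossing a cut whose sides are joined on both sides give a long cycle. -/
theorem cut_bound {c : ℕ}
    (hc : ∀ (a : V) (w : G.Walk a a), w.IsCycle → w.length ≤ c)
    {x y : MGPoint G} {S : Set V} {w v w' v' : V} {τ τ' : ℝ}
    (hx : OnEdge G x w v τ) (hy : OnEdge G y w' v' τ')
    (hw : w ∉ S) (hv : v ∈ S) (hw' : w' ∉ S) (hv' : v' ∈ S)
    (hI : WJoined G S v v') (hQ : WJoined G Sᶜ w w') (hd : 1 < mgDist G x y) :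
    2 * mgDist G x y ≤ c := by
  obtain ⟨I0, hI0⟩ := hI
  obtain ⟨Q0, hQ0⟩ := hQ
  have hIp := I0.bypass_isPath
  have hQp := Q0.bypass_isPath
  have hIs : ∀ z ∈ I0.bypass.support, z ∈ S := fun z hz =>
    hI0 z (I0.support_bypass_subset_support hz)
  have hQs : ∀ z ∈ Q0.bypass.support, z ∉ S := fun z hz =>
    hQ0 z (Q0.support_bypass_subset_support hz)
  generalize I0.bypass = I at hIp hIs
  generalize Q0.bypass = Q at hQp hQs
  have hp : (Walk.cons hx.adj I).IsPath := by
    rw [Walk.cons_isPath_iff]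
    exact ⟨hIp, fun h => hw (hIs _ h)⟩
  have hq : (Walk.cons hy.adj.symm Q.reverse).IsPath := by
    rw [Walk.cons_isPath_iff]
    refine ⟨hQp.reverse, fun h => hQs v' ?_ hv'⟩
    simpa using h
  have hcyc : ((Walk.cons hx.adj I).append (Walk.cons hy.adj.symm Q.reverse)).IsCycle := by
    refine hp.isCycle_append hq ?_ ?_
    · simp only [Walk.support_cons, List.tail_cons]
      intro z hz hz'
      exact hQs z (by simpa using hz') (hIs z hz)
    · by_contra hcon
      simp only [Walk.length_cons, Walk.length_reverse, not_or, not_lt] at hcon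
      have h1 : I.length = 0 := by omega
      have h2 : Q.length = 0 := by omega
      have e1 := Walk.eq_of_length_eq_zero h1
      have e2 := Walk.eq_of_length_eq_zero h2
      subst e1 e2
      have := mgDist_le_same hx hy
      have a1 := hx.nonneg
      have a2 := hx.le_one
      have a3 := hy.nonneg
      have a4 := hy.le_one
      have : |τ - τ'| ≤ 1 := abs_le.2 ⟨by linarith, by linarith⟩
      linarith
  have hlen := hc _ _ hcyc
  simp only [Walk.length_append, Walk.length_cons, Walk.length_reverse] at hlen
  have h1 : G.dist v v' ≤ I.length := G.dist_le I
  have h2 : G.dist w w' ≤ Q.length := G.dist_le Q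
  have h3 : (G.dist v v' : ℝ) + G.dist w w' + 2 ≤ c := by
    exact_mod_cast (by omega : G.dist v v' + G.dist w w' + 2 ≤ c)
  have h4 := mgDist_le_via hx hy
  have h5 := mgDist_le_via hx.flip hy.flip
  linarith

/-- Propagation of a property along an interval. -/
theorem interval_prop {K : ℝ → Prop} {a b ε : ℝ} (hε : 0 < ε)
    (hK : ∀ s ∈ Icc a b, ∀ t ∈ Icc a b, |s - t| < ε → K s → K t) :
    ∀ s ∈ Icc a b, ∀ t ∈ Icc a b, K s → K t := by
  intro s hs t ht h
  obtain ⟨N, hN⟩ := exists_nat_gt (|t - s| / ε)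
  have hN0 : (0 : ℝ) < N := lt_of_le_of_lt (by positivity) hN
  have hmem : ∀ k : ℕ, k ≤ N → s + (t - s) * (k / N) ∈ Icc a b := by
    intro k hk
    have h1 : (k : ℝ) / N ≤ 1 := by
      rw [div_le_one hN0]; exact_mod_cast hk
    have h0 : (0 : ℝ) ≤ (k : ℝ) / N := by positivity
    have := hs.1; have := hs.2; have := ht.1; have := ht.2
    constructor <;> nlinarith
  have : ∀ k : ℕ, k ≤ N → K (s + (t - s) * (k / N)) := by
    intro k
    induction k with
    | zero => intro _; simpa using h
    | succ k ih =>
      intro hk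
      refine hK _ (hmem k (by omega)) _ (hmem (k + 1) hk) ?_ (ih (by omega))
      have e : s + (t - s) * ((k : ℕ) / N) - (s + (t - s) * (((k + 1 : ℕ) : ℝ) / N)) =
        -((t - s) / N) := by
        push_cast; field_simp; ring
      rw [e, abs_neg, abs_div, abs_of_pos hN0]
      rw [div_lt_iff₀ hε] at hN
      rw [div_lt_iff₀ hN0]
      linarith
  have := this N le_rfl
  rwa [div_self hN0.ne', mul_one, add_sub_cancel] at this

/-- The ball around a point is joined. -/
theorem ball_joined (hG : G.Connected) (p : MGPoint G) (r : ℝ) {v v' : V}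
    (hv : mgVDist G v p < r) (hv' : mgVDist G v' p < r) :
    WJoined G {z | mgVDist G z p < r} v v' := by
  have key : ∀ v, mgVDist G v p < r → ∃ e o τ, OnEdge G p e o τ ∧
      WJoined G {z | mgVDist G z p < r} v e := by
    intro v hv
    obtain ⟨e, o, τ, h, hd⟩ := mgVDist_cases p v
    refine ⟨e, o, τ, h, ?_⟩
    obtain ⟨w, hw⟩ := hG.exists_walk_length_eq_dist v e
    refine ⟨w, fun z hz => ?_⟩
    have h1 : G.dist z e ≤ G.dist v e := by
      rw [← hw]
      exact (G.dist_le (w.dropUntil z hz)).trans (w.length_dropUntil_le_length hz)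
    have h2 := mgVDist_le h z
    have h1' : (G.dist z e : ℝ) ≤ G.dist v e := by exact_mod_cast h1
    show mgVDist G z p < r
    linarith
  obtain ⟨e, o, τ, h, hj⟩ := key v hv
  obtain ⟨e', o', τ', h', hj'⟩ := key v' hv'
  have he : mgVDist G e p < r := by
    obtain ⟨w, hw⟩ := hj
    exact hw _ w.end_mem_support
  have he' : mgVDist G e' p < r := by
    obtain ⟨w, hw⟩ := hj'
    exact hw _ w.end_mem_support
  rcases h.unique h' with ⟨rfl, rfl, _⟩ | ⟨rfl, rfl, _⟩
  · exact hj.trans hj'.symm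
  · exact (hj.trans (WJoined.adj h.adj he he')).trans hj'.symm

theorem exists_gap [Nonempty V] (f : V → ℝ) (r : ℝ) :
    ∃ ε : ℝ, 0 < ε ∧ ε ≤ 1 ∧ ∀ v, f v < r → f v ≤ r - ε := by
  obtain ⟨v0, hv0⟩ := Finite.exists_min (fun v => if f v < r then r - f v else 1)
  refine ⟨min 1 (if f v0 < r then r - f v0 else 1), ?_, min_le_left _ _, ?_⟩
  · apply lt_min one_pos
    split_ifs with h
    · linarith
    · exact one_pos
  · intro v hv
    have h1 := hv0 v
    have h2 := min_le_right 1 (if f v0 < r then r - f v0 else 1)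
    simp only [hv, if_true] at h1
    linarith

theorem thin_aux (hG : G.Connected) {c : ℕ} (hc3 : 3 ≤ c)
    (hc : ∀ (a : V) (w : G.Walk a a), w.IsCycle → w.length ≤ c)
    {a1 b1 a2 b2 a3 b3 : ℝ} {g1 g2 g3 : ℝ → MGPoint G}
    (h1 : IsMGGeodesic G a1 b1 g1) (h2 : IsMGGeodesic G a2 b2 g2) (h3 : IsMGGeodesic G a3 b3 g3)
    (glue1 : mgDist G (g1 b1) (g2 a2) = 0) (glue2 : mgDist G (g2 b2) (g3 a3) = 0)
    (glue3 : mgDist G (g3 b3) (g1 a1) = 0) {R : ℝ} (hR : (c : ℝ) / 4 < R)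
    (s0 : ℝ) (hs0 : s0 ∈ Icc a1 b1) :
    (∃ t ∈ Icc a2 b2, mgDist G (g1 s0) (g2 t) ≤ R) ∨
      (∃ t ∈ Icc a3 b3, mgDist G (g1 s0) (g3 t) ≤ R) := by
  by_contra hcon
  push Not at hcon
  obtain ⟨hf2, hf3⟩ := hcon
  set p := g1 s0 with hp
  have : Nonempty V := hG.nonempty
  obtain ⟨r, ⟨hr1, hr2⟩, hgen⟩ : ∃ r, r ∈ Ioo ((c : ℝ) / 4) R ∧ ∀ v, mgVDist G v p ≠ r := by
    obtain ⟨r, hr, hn⟩ := ((Set.Ioo_infinite hR).sdiff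
      (Set.finite_range (fun v => mgVDist G v p))).nonempty
    exact ⟨r, hr, fun v hv => hn ⟨v, hv⟩⟩
  obtain ⟨ε, hε0, hε1, hgap⟩ := exists_gap (fun v => mgVDist G v p) r
  have hc3' : (3 : ℝ) ≤ c := by exact_mod_cast hc3
  set S : Set V := {z | mgVDist G z p < r} with hS
  have step : ∀ Q Q' : MGPoint G, r ≤ mgDist G p Q → mgDist G Q Q' < ε →
      (∃ e o τ o' τ', OnEdge G Q e o τ ∧ OnEdge G Q' e o' τ' ∧ e ∉ S) ∨
      (∃ e o τ τ', OnEdge G Q e o τ ∧ OnEdge G Q' e o τ') := by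
    intro Q Q' hQ hd
    rcases mgDist_cases hG Q Q' with ⟨e, o, τ, e', o', τ', h, h', he⟩ | ⟨e, o, τ, τ', h, h', _⟩
    · left
      have n1 := h.nonneg
      have n2 := h'.nonneg
      have hz : (G.dist e e' : ℝ) < 1 := by linarith
      have hz' : G.dist e e' = 0 := by
        have : G.dist e e' < 1 := by exact_mod_cast hz
        omega
      have hee := hG.dist_eq_zero_iff.1 hz'
      subst hee
      refine ⟨e, o, τ, o', τ', h, h', fun heS => ?_⟩
      have k1 := hgap e heS
      have k2 := mgDist_le_mgVDist p h
      have : (0 : ℝ) ≤ G.dist e e := by positivity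
      linarith
    · right; exact ⟨e, o, τ, τ', h, h'⟩
  have gd : ∀ s ∈ Icc a1 b1, mgDist G p (g1 s) = |s0 - s| := fun s hs => h1.2 s0 hs0 s hs
  have ha1 : a1 ∈ Icc a1 b1 := ⟨le_rfl, h1.1⟩
  have hb1 : b1 ∈ Icc a1 b1 := ⟨h1.1, le_rfl⟩
  have ha2 : a2 ∈ Icc a2 b2 := ⟨le_rfl, h2.1⟩
  have hb2 : b2 ∈ Icc a2 b2 := ⟨h2.1, le_rfl⟩
  have ha3 : a3 ∈ Icc a3 b3 := ⟨le_rfl, h3.1⟩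
  have hb3 : b3 ∈ Icc a3 b3 := ⟨h3.1, le_rfl⟩
  have hleft : a1 ≤ s0 - r := by
    have t1 := hf3 b3 hb3
    have t2 := mgDist_triangle hG p (g1 a1) (g3 b3)
    rw [mgDist_comm hG (g1 a1), glue3, gd a1 ha1, abs_of_nonneg (by linarith [hs0.1])] at t2
    linarith
  have hright : s0 + r ≤ b1 := by
    have t1 := hf2 a2 ha2
    have t2 := mgDist_triangle hG p (g1 b1) (g2 a2)
    rw [glue1, gd b1 hb1, abs_sub_comm, abs_of_nonneg (by linarith [hs0.2])] at t2
    linarith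
  have hxm : s0 - r ∈ Icc a1 b1 := ⟨hleft, by linarith [hs0.2]⟩
  have hym : s0 + r ∈ Icc a1 b1 := ⟨by linarith [hs0.1], hright⟩
  have hxd : mgDist G p (g1 (s0 - r)) = r := by
    rw [gd _ hxm, sub_sub_cancel, abs_of_pos (by linarith)]
  have hyd : mgDist G p (g1 (s0 + r)) = r := by
    rw [gd _ hym, abs_sub_comm, add_sub_cancel_left, abs_of_pos (by linarith)]
  have hxy : mgDist G (g1 (s0 - r)) (g1 (s0 + r)) = 2 * r := by
    rw [h1.2 _ hxm _ hym, abs_sub_comm, abs_of_pos (by linarith)]; ring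
  have chain : ∀ K : MGPoint G → Prop,
      (∀ Q Q' : MGPoint G, r ≤ mgDist G p Q → mgDist G Q Q' < ε → K Q → K Q') →
      K (g1 (s0 - r)) → K (g1 (s0 + r)) := by
    intro K hK hKx
    have seg : ∀ (a b : ℝ) (g : ℝ → MGPoint G),
        (∀ s ∈ Icc a b, ∀ t ∈ Icc a b, mgDist G (g s) (g t) = |s - t|) →
        (∀ s ∈ Icc a b, r ≤ mgDist G p (g s)) →
        ∀ s ∈ Icc a b, ∀ t ∈ Icc a b, K (g s) → K (g t) := by
      intro a b g hg hr
      apply interval_prop (K := fun s => K (g s)) hε0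
      intro s hs t ht hst
      exact hK _ _ (hr s hs) (by rw [hg s hs t ht]; exact hst)
    have k1 : K (g1 a1) := by
      refine seg a1 (s0 - r) g1 (fun s hs t ht => h1.2 s ⟨hs.1, hs.2.trans hxm.2⟩ t
        ⟨ht.1, ht.2.trans hxm.2⟩) ?_ (s0 - r) ⟨hleft, le_rfl⟩ a1 ⟨le_rfl, hleft⟩ hKx
      intro s hs
      rw [gd s ⟨hs.1, hs.2.trans hxm.2⟩]
      exact le_trans (by linarith [hs.2]) (le_abs_self _)
    have k2 : K (g3 b3) := by
      refine hK _ _ ?_ ?_ k1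
      · rw [gd a1 ha1]
        exact le_trans (by linarith) (le_abs_self _)
      · rw [mgDist_comm hG, glue3]; exact hε0
    have k3 : K (g3 a3) := seg a3 b3 g3 h3.2 (fun s hs => by linarith [hf3 s hs]) _ hb3 _ ha3 k2
    have k4 : K (g2 b2) := by
      refine hK _ _ ?_ ?_ k3
      · linarith [hf3 a3 ha3]
      · rw [mgDist_comm hG, glue2]; exact hε0
    have k5 : K (g2 a2) := seg a2 b2 g2 h2.2 (fun s hs => by linarith [hf2 s hs]) _ hb2 _ ha2 k4
    have k6 : K (g1 b1) := by
      refine hK _ _ ?_ ?_ k5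
      · linarith [hf2 a2 ha2]
      · rw [mgDist_comm hG, glue1]; exact hε0
    refine seg (s0 + r) b1 g1 (fun s hs t ht => h1.2 s ⟨hym.1.trans hs.1, hs.2⟩ t
        ⟨hym.1.trans ht.1, ht.2⟩) ?_ b1 ⟨hright, le_rfl⟩ (s0 + r) ⟨le_rfl, hright⟩ k6
    intro s hs
    rw [gd s ⟨hym.1.trans hs.1, hs.2⟩, abs_sub_comm]
    exact le_trans (by linarith [hs.1]) (le_abs_self _)
  have bdry : ∀ Q : MGPoint G, mgDist G p Q = r → ∃ w v τ, OnEdge G Q w v τ ∧ v ∈ S := by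
    intro Q hQ
    rcases mgDist_cases hG p Q with ⟨e, o, τ, e', o', τ', h, h', he⟩ | ⟨e, o, τ, τ', h, h', he⟩
    · refine ⟨o', e', 1 - τ', h'.flip, ?_⟩
      have k := mgVDist_le h e'
      rw [G.dist_comm] at k
      exact lt_of_le_of_ne (by linarith [h'.nonneg]) (hgen e')
    · have k := mgVDist_le h e
      have k' := mgVDist_le h.flip o
      simp only [SimpleGraph.dist_self, Nat.cast_zero, zero_add] at k k'
      by_cases hτ : τ ≤ 1 / 2
      · exact ⟨o, e, 1 - τ', h'.flip, lt_of_le_of_lt k (by linarith)⟩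
      · exact ⟨e, o, τ', h', lt_of_le_of_lt k' (by linarith)⟩
  obtain ⟨w, v, τ, hx, hv⟩ := bdry _ hxd
  obtain ⟨w', v', τ', hy, hv'⟩ := bdry _ hyd
  have hw : w ∉ S := by
    intro hw
    have := chain (fun Q => ∃ σ, OnEdge G Q w v σ) ?_ ⟨τ, hx⟩
    · obtain ⟨σ, hσ⟩ := this
      have b := mgDist_le_same hx hσ
      have n1 := hx.nonneg
      have n2 := hx.le_one
      have n3 := hσ.nonneg
      have n4 := hσ.le_one
      have : |τ - σ| ≤ 1 := abs_le.2 ⟨by linarith, by linarith⟩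
      linarith
    · rintro Q Q' hQ hd ⟨σ, hσ⟩
      rcases step Q Q' hQ hd with ⟨e, o, t, o', t', k, k', ke⟩ | ⟨e, o, t, t', k, k'⟩
      · exfalso
        rcases hσ.unique k with ⟨rfl, rfl, _⟩ | ⟨rfl, rfl, _⟩
        · exact ke hw
        · exact ke hv
      · rcases hσ.unique k with ⟨rfl, rfl, _⟩ | ⟨rfl, rfl, _⟩
        · exact ⟨_, k'⟩
        · exact ⟨_, k'.flip⟩
  have hend := chain (fun Q => ∃ e o σ, OnEdge G Q e o σ ∧ e ∉ S ∧ WJoined G Sᶜ w e) ?_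
    ⟨w, v, τ, hx, hw, WJoined.refl hw⟩
  · obtain ⟨e, o, σ, hσ, he, hj⟩ := hend
    have : e = w' := by
      rcases hσ.unique hy with ⟨rfl, rfl, _⟩ | ⟨rfl, rfl, _⟩
      · rfl
      · exact absurd hv' he
    subst this
    have := cut_bound hc hx hy hw hv he hv' (ball_joined hG p r hv hv') hj (by linarith)
    linarith
  · rintro Q Q' hQ hd ⟨e, o, σ, hσ, he, hj⟩
    rcases step Q Q' hQ hd with ⟨f, q, t, q', t', k, k', kf⟩ | ⟨f, q, t, t', k, k'⟩
    · refine ⟨f, q', t', k', kf, ?_⟩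
      rcases hσ.unique k with ⟨rfl, rfl, _⟩ | ⟨rfl, rfl, _⟩
      · exact hj
      · exact hj.trans (WJoined.adj hσ.adj he kf)
    · rcases hσ.unique k with ⟨rfl, rfl, _⟩ | ⟨rfl, rfl, _⟩
      · exact ⟨_, _, _, k', he, hj⟩
      · exact ⟨_, _, _, k'.flip, he, hj⟩

/-- The set in the definition of `triangleDelta`. -/
theorem mem_thin_set (hG : G.Connected) {c : ℕ} (hc3 : 3 ≤ c)
    (hc : ∀ (a : V) (w : G.Walk a a), w.IsCycle → w.length ≤ c) (T : MGTriangle G)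
    {d : ℝ} (hd : (c : ℝ) / 4 < d) : 0 ≤ d ∧
    (∀ s ∈ Set.Icc T.a1 T.b1,
      (∃ t ∈ Set.Icc T.a2 T.b2, mgDist G (T.g1 s) (T.g2 t) ≤ d) ∨
      (∃ t ∈ Set.Icc T.a3 T.b3, mgDist G (T.g1 s) (T.g3 t) ≤ d)) ∧
    (∀ s ∈ Set.Icc T.a2 T.b2,
      (∃ t ∈ Set.Icc T.a1 T.b1, mgDist G (T.g2 s) (T.g1 t) ≤ d) ∨
      (∃ t ∈ Set.Icc T.a3 T.b3, mgDist G (T.g2 s) (T.g3 t) ≤ d)) ∧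
    (∀ s ∈ Set.Icc T.a3 T.b3,
      (∃ t ∈ Set.Icc T.a1 T.b1, mgDist G (T.g3 s) (T.g1 t) ≤ d) ∨
      (∃ t ∈ Set.Icc T.a2 T.b2, mgDist G (T.g3 s) (T.g2 t) ≤ d)) := by
  refine ⟨?_, ?_, ?_, ?_⟩
  · have : (0 : ℝ) ≤ c := by positivity
    linarith
  · exact thin_aux hG hc3 hc T.h1 T.h2 T.h3 T.glue1 T.glue2 T.glue3 hd
  · intro s hs
    exact (thin_aux hG hc3 hc T.h2 T.h3 T.h1 T.glue2 T.glue3 T.glue1 hd s hs).symm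
  · exact thin_aux hG hc3 hc T.h3 T.h1 T.h2 T.glue3 T.glue1 T.glue2 hd

theorem triangleDelta_le (hG : G.Connected) {c : ℕ} (hc3 : 3 ≤ c)
    (hc : ∀ (a : V) (w : G.Walk a a), w.IsCycle → w.length ≤ c) (T : MGTriangle G) :
    triangleDelta T ≤ (c : ℝ) / 4 := by
  apply le_of_forall_gt_imp_ge_of_dense
  intro d hd
  exact csInf_le ⟨0, fun x hx => hx.1⟩ (mem_thin_set hG hc3 hc T hd)

theorem hypDelta_le (hG : G.Connected) {c : ℕ} (hc3 : 3 ≤ c)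
    (hc : ∀ (a : V) (w : G.Walk a a), w.IsCycle → w.length ≤ c) :
    hypDelta G ≤ (c : ℝ) / 4 := by
  apply Real.sSup_le
  · rintro d ⟨T, rfl⟩
    exact triangleDelta_le hG hc3 hc T
  · positivity

theorem length_le_circumference {a : V} {w : G.Walk a a} (hw : w.IsCycle) :
    w.length ≤ circumference G := by
  apply le_csSup
  · refine ⟨Fintype.card V, ?_⟩
    rintro n ⟨b, v, hv, rfl⟩
    have := hv.isPath_tail.length_lt
    have h' := Walk.length_tail_add_one hv.not_nil
    omega
  · exact ⟨a, w, hw, rfl⟩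

end MG2

section MG3
set_option linter.unusedSectionVars false
variable {V : Type} [Fintype V] [DecidableEq V] {G : SimpleGraph V}

/-- The distance from `x` to the lattice `cℤ`. -/
noncomputable def cD (c : ℕ) (x : ℝ) : ℝ := |x - c * round (x / c)|

theorem cD_le {c : ℕ} (hc : 0 < c) (x : ℝ) (m : ℤ) : cD c x ≤ |x - c * m| := by
  have h := round_le (x / c) m
  have hc' : (0 : ℝ) < c := by exact_mod_cast hc
  have e : ∀ r : ℝ, |x - c * r| = c * |x / c - r| := by
    intro r
    rw [← abs_of_pos hc', ← abs_mul, abs_of_pos hc']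
    congr 1
    field_simp
  unfold cD
  rw [e, e]
  exact mul_le_mul_of_nonneg_left h hc'.le

theorem cD_exists (c : ℕ) (x : ℝ) : ∃ m : ℤ, cD c x = |x - c * m| := ⟨_, rfl⟩

theorem cD_lip {c : ℕ} (hc : 0 < c) (x y : ℝ) : |cD c x - cD c y| ≤ |x - y| := by
  have key : ∀ x y, cD c x - cD c y ≤ |x - y| := by
    intro x y
    obtain ⟨m, hm⟩ := cD_exists c y
    have := cD_le hc x m
    have h := abs_sub_abs_le_abs_sub (x - c * m) (y - c * m)
    rw [sub_sub_sub_cancel_right] at h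
    linarith
  rw [abs_le]
  constructor
  · have := key y x
    rw [abs_sub_comm] at this
    linarith
  · exact key x y

theorem cD_periodic {c : ℕ} (hc : 0 < c) (x : ℝ) (m : ℤ) : cD c (x + c * m) = cD c x := by
  have key : ∀ x (m : ℤ), cD c (x + c * m) ≤ cD c x := by
    intro x m
    obtain ⟨k, hk⟩ := cD_exists c x
    have := cD_le hc (x + c * m) (k + m)
    rw [hk]
    refine this.trans (le_of_eq ?_)
    congr 1
    push_cast
    ring
  apply le_antisymm (key x m)
  have := key (x + c * m) (-m)
  push_cast at this
  rwa [show x + c * m + c * -(m : ℝ) = x by ring] at this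

theorem cD_eq {c : ℕ} (hc : 0 < c) {x : ℝ} (hx : |x| ≤ c / 2) : cD c x = |x| := by
  have hc' : (0 : ℝ) < c := by exact_mod_cast hc
  apply le_antisymm
  · simpa using cD_le hc x 0
  · obtain ⟨m, hm⟩ := cD_exists c x
    rw [hm]
    rcases eq_or_ne m 0 with rfl | h0
    · simp
    · have h1 : (1 : ℝ) ≤ |(m : ℝ)| := by
        exact_mod_cast Int.one_le_abs h0
      have h2 := abs_sub_abs_le_abs_sub (c * m : ℝ) x
      rw [abs_mul, abs_of_pos hc', abs_sub_comm] at h2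
      nlinarith

theorem cD_eq_sub {c : ℕ} (hc : 0 < c) {x : ℝ} (hx : (c : ℝ) / 2 ≤ x) (hx' : x ≤ c) :
    cD c x = c - x := by
  have h := cD_periodic hc x (-1)
  rw [← h, cD_eq hc]
  · rw [abs_of_nonpos (by push_cast; linarith)]
    push_cast; ring
  · rw [abs_of_nonpos (by push_cast; linarith)]
    push_cast; linarith

theorem cD_nonneg (c : ℕ) (x : ℝ) : 0 ≤ cD c x := abs_nonneg _

/-- Arc-length parametrization of a closed walk. -/
noncomputable def cyPoint (z : ℤ → V) (hz : ∀ k, G.Adj (z k) (z (k + 1))) (θ : ℝ) : MGPoint G :=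
  ⟨(z ⌊θ⌋, z (⌊θ⌋ + 1), Int.fract θ), hz _, Int.fract_nonneg _, (Int.fract_lt_one _).le⟩

theorem cyPoint_onEdge (z : ℤ → V) (hz : ∀ k, G.Adj (z k) (z (k + 1))) (θ : ℝ) :
    OnEdge G (cyPoint z hz θ) (z ⌊θ⌋) (z (⌊θ⌋ + 1)) (θ - ⌊θ⌋) :=
  Or.inl ⟨rfl, rfl, rfl⟩

theorem cyPoint_dist (hG : G.Connected) (z : ℤ → V) (hz : ∀ k, G.Adj (z k) (z (k + 1))) (k : ℤ) (m : ℕ) :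
    G.dist (z k) (z (k + m)) ≤ m := by
  induction m with
  | zero => simp
  | succ m ih =>
    have h := hG.dist_triangle (u := z k) (v := z (k + m)) (w := z (k + m + 1))
    rw [SimpleGraph.dist_eq_one_iff_adj.mpr (hz (k + m))] at h
    rw [show k + ((m + 1 : ℕ) : ℤ) = k + m + 1 by push_cast; ring]
    omega

theorem cyPoint_upper (hG : G.Connected) (z : ℤ → V) (hz : ∀ k, G.Adj (z k) (z (k + 1))) (s t : ℝ) :
    mgDist G (cyPoint z hz s) (cyPoint z hz t) ≤ |s - t| := by
  wlog hst : s ≤ t generalizing s t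
  · rw [mgDist_comm hG, abs_sub_comm]
    exact this t s (le_of_not_ge hst)
  have hs := cyPoint_onEdge z hz s
  have ht := cyPoint_onEdge z hz t
  rcases eq_or_lt_of_le (Int.floor_le_floor hst) with h | h
  · rw [← h] at ht
    have := mgDist_le_same hs ht
    rwa [sub_sub_sub_cancel_right] at this
  · have h1 := mgDist_le_via hs.flip ht
    obtain ⟨m, hm⟩ := Int.le.dest (Int.add_one_le_iff.2 h)
    have h2 := cyPoint_dist hG z hz (⌊s⌋ + 1) m
    rw [hm] at h2
    have h3 : (G.dist (z (⌊s⌋ + 1)) (z ⌊t⌋) : ℝ) ≤ m := by exact_mod_cast h2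
    have h4 : (⌊s⌋ : ℝ) + 1 + m = ⌊t⌋ := by exact_mod_cast hm
    rw [abs_of_nonpos (by linarith)]
    linarith

theorem lip_dist (hG : G.Connected) {H : V → ℝ} (hH : ∀ u v, G.Adj u v → H u - H v ≤ 1) (u v : V) :
    |H u - H v| ≤ G.dist u v := by
  have key : ∀ u v (w : G.Walk u v), H u - H v ≤ w.length := by
    intro u v w
    induction w with
    | nil => simp
    | cons h p ih =>
      have := hH _ _ h
      rw [Walk.length_cons]
      push_cast
      linarith
  rw [abs_le]
  obtain ⟨w, hw⟩ := hG.exists_walk_length_eq_dist u v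
  have h1 := key u v w
  have h2 := key v u w.reverse
  rw [Walk.length_reverse] at h2
  rw [hw] at h1 h2
  constructor <;> linarith

theorem cyPoint_lower (hG : G.Connected) {c : ℕ} (hc3 : 3 ≤ c) (z : ℤ → V)
    (hz : ∀ k, G.Adj (z k) (z (k + 1))) (hinj : ∀ k l, z k = z l → (c : ℤ) ∣ k - l)
    {H : V → ℝ} (hH : ∀ u v, G.Adj u v → H u - H v ≤ 1) {C : ℝ → ℝ}
    (hC : ∀ x y, |C x - C y| ≤ |x - y|) (hp : ∀ x (m : ℤ), C (x + c * m) = C x)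
    (hHC : ∀ k : ℤ, H (z k) = C k) (s t : ℝ) :
    |C s - C t| ≤ mgDist G (cyPoint z hz s) (cyPoint z hz t) := by
  have key : ∀ s e o τ, OnEdge G (cyPoint z hz s) e o τ → |H e - C s| ≤ τ := by
    intro s e o τ h
    have h0 := Int.floor_le s
    have h1 := (Int.lt_floor_add_one s).le
    rcases h.unique (cyPoint_onEdge z hz s) with ⟨rfl, rfl, rfl⟩ | ⟨rfl, rfl, rfl⟩
    · rw [hHC]
      refine (hC _ _).trans ?_
      rw [abs_of_nonpos (by linarith)]; linarith
    · rw [hHC]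
      refine (hC _ _).trans ?_
      push_cast
      rw [abs_of_nonneg (by linarith)]; linarith
  have same : ∀ s t : ℝ, (c : ℤ) ∣ ⌊s⌋ - ⌊t⌋ → |C s - C t| ≤ |(s - ⌊s⌋) - (t - ⌊t⌋)| := by
    intro s t ⟨m, hm⟩
    rw [← hp t m]
    refine (hC _ _).trans (le_of_eq ?_)
    have : (⌊s⌋ : ℝ) - ⌊t⌋ = c * m := by exact_mod_cast hm
    congr 1
    linarith
  rcases mgDist_cases hG (cyPoint z hz s) (cyPoint z hz t) with
    ⟨e, o, τ, e', o', τ', h, h', hd⟩ | ⟨e, o, τ, τ', h, h', hd⟩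
  · rw [hd]
    have h1 := key _ _ _ _ h
    have h2 := key _ _ _ _ h'
    have h3 := lip_dist hG hH e e'
    rw [abs_le] at *
    constructor <;> linarith
  · rw [hd]
    have bad : ∀ k l : ℤ, z k = z (l + 1) → z (k + 1) = z l → False := by
      intro k l h1 h2
      have h1 := hinj _ _ h1
      have h2 := hinj _ _ h2
      have h3 : (c : ℤ) ∣ 2 := by
        have := dvd_sub h2 h1
        rwa [show k + 1 - l - (k - (l + 1)) = 2 by ring] at this
      have := Int.le_of_dvd (by norm_num) h3
      omega
    rcases h.unique (cyPoint_onEdge z hz s) with ⟨r1, r2, r3⟩ | ⟨r1, r2, r3⟩ <;>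
    rcases h'.unique (cyPoint_onEdge z hz t) with ⟨q1, q2, q3⟩ | ⟨q1, q2, q3⟩
    · rw [r3, q3]; exact same s t (hinj _ _ (r1 ▸ q1))
    · exact (bad _ _ (r1 ▸ q1) (r2 ▸ q2)).elim
    · exact (bad _ _ (r2 ▸ q2) (r1 ▸ q1)).elim
    · rw [r3, q3, show 1 - (s - ⌊s⌋ : ℝ) - (1 - (t - ⌊t⌋)) = -(s - ⌊s⌋ - (t - ⌊t⌋)) by ring, abs_neg]
      exact same s t (hinj _ _ (r2 ▸ q2))

theorem hypDelta_ge (hG : G.Connected) {c : ℕ} (hc3 : 3 ≤ c)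
    (hc : ∀ (a : V) (w : G.Walk a a), w.IsCycle → w.length ≤ c) (z : ℤ → V)
    (hz : ∀ k, G.Adj (z k) (z (k + 1))) (hinj : ∀ k l, z k = z l → (c : ℤ) ∣ k - l)
    (hper : ∀ k, z (k + c) = z k) (θ : ℝ)
    {H0 : V → ℝ} (hH0 : ∀ u v, G.Adj u v → H0 u - H0 v ≤ 1)
    (hHC0 : ∀ k : ℤ, H0 (z k) = cD c (k - θ))
    {H1 : V → ℝ} (hH1 : ∀ u v, G.Adj u v → H1 u - H1 v ≤ 1)
    (hHC1 : ∀ k : ℤ, H1 (z k) = min ((c : ℝ) / 4) (cD c (k - θ - c / 4))) :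
    (c : ℝ) / 4 ≤ hypDelta G := by
  have hc0 : 0 < c := by omega
  have hcr : (0 : ℝ) < c := by exact_mod_cast hc0
  have L0 := cyPoint_lower hG hc3 z hz hinj hH0 (C := fun x => cD c (x - θ))
    (fun x y => by simpa using cD_lip hc0 (x - θ) (y - θ))
    (fun x m => by
      show cD c _ = cD c _
      rw [← cD_periodic hc0 (x - θ) m]; congr 1; ring) hHC0
  have L1 := cyPoint_lower hG hc3 z hz hinj hH1
    (C := fun x => min ((c : ℝ) / 4) (cD c (x - θ - c / 4)))
    (fun x y => by
      refine (abs_min_sub_min_le_max _ _ _ _).trans ?_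
      simpa using cD_lip hc0 (x - θ - c / 4) (y - θ - c / 4))
    (fun x m => by
      show min _ (cD c _) = min _ (cD c _)
      rw [← cD_periodic hc0 (x - θ - c / 4) m]; congr 2; ring) hHC1
  have U := cyPoint_upper hG z hz
  have g1 : IsMGGeodesic G θ (θ + c / 2) (cyPoint z hz) := by
    refine ⟨by linarith, fun s hs t ht => le_antisymm (U s t) ?_⟩
    have := L0 s t
    rw [cD_eq hc0 (by rw [abs_of_nonneg] <;> linarith [hs.1, hs.2]),
      cD_eq hc0 (by rw [abs_of_nonneg] <;> linarith [ht.1, ht.2]),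
      abs_of_nonneg (by linarith [hs.1] : 0 ≤ s - θ),
      abs_of_nonneg (by linarith [ht.1] : 0 ≤ t - θ)] at this
    simpa using this
  have g2 : IsMGGeodesic G (θ + c / 2) (θ + c) (cyPoint z hz) := by
    refine ⟨by linarith, fun s hs t ht => le_antisymm (U s t) ?_⟩
    have := L0 s t
    rw [cD_eq_sub hc0 (by linarith [hs.1, hs.2]) (by linarith [hs.1, hs.2]),
      cD_eq_sub hc0 (by linarith [ht.1, ht.2]) (by linarith [ht.1, ht.2])] at this
    rw [abs_sub_comm]
    refine le_trans (le_of_eq ?_) this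
    congr 1; ring
  have g3 : IsMGGeodesic G (θ + c) (θ + c) (cyPoint z hz) := by
    refine ⟨le_rfl, fun s hs t ht => ?_⟩
    have : s = t := (le_antisymm hs.2 hs.1).trans (le_antisymm ht.1 ht.2)
    subst this
    simp [mgDist_self hG]
  have gl : cyPoint z hz (θ + c) = cyPoint z hz θ := by
    apply Subtype.ext
    have : ⌊θ + (c : ℝ)⌋ = ⌊θ⌋ + c := by exact_mod_cast Int.floor_add_natCast θ c
    simp only [cyPoint, this, hper]
    rw [show ⌊θ⌋ + (c : ℤ) + 1 = ⌊θ⌋ + 1 + c by ring, hper, Int.fract_add_natCast]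
  let T : MGTriangle G := ⟨θ, θ + c / 2, θ + c / 2, θ + c, θ + c, θ + c, cyPoint z hz, cyPoint z hz,
    cyPoint z hz, g1, g2, g3, mgDist_self hG _, mgDist_self hG _, by rw [gl]; exact mgDist_self hG _⟩
  have hT : (c : ℝ) / 4 ≤ triangleDelta T := by
    apply le_csInf
    · exact ⟨c / 4 + 1, mem_thin_set hG hc3 hc T (by linarith)⟩
    · rintro d ⟨-, hd, -, -⟩
      have far : ∀ t, θ + c / 2 ≤ t → t ≤ θ + c →
          (c : ℝ) / 4 ≤ mgDist G (cyPoint z hz (θ + c / 4)) (cyPoint z hz t) := by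
        intro t h1 h2
        have := L1 (θ + c / 4) t
        have e1 : cD c (θ + c / 4 - θ - c / 4) = 0 := by
          rw [cD_eq hc0] <;> ring_nf <;> simp
        have e2 : (c : ℝ) / 4 ≤ cD c (t - θ - c / 4) := by
          rcases le_total (t - θ - c / 4) (c / 2) with h | h
          · rw [cD_eq hc0 (by rw [abs_of_nonneg] <;> linarith), abs_of_nonneg] <;> linarith
          · rw [cD_eq_sub hc0 h (by linarith)]; linarith
        rw [e1, min_eq_left e2, min_eq_right (by positivity), zero_sub, abs_neg,
          abs_of_pos (by positivity)] at this
        exact this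
      rcases hd (θ + c / 4) ⟨by show θ ≤ _; linarith, by show _ ≤ θ + c / 2; linarith⟩ with
        ⟨t, ht, h⟩ | ⟨t, ht, h⟩
      · exact (far t ht.1 ht.2).trans h
      · exact (far t (le_trans (by linarith) ht.1) ht.2).trans h
  refine hT.trans (le_csSup ⟨c / 4, ?_⟩ ⟨T, rfl⟩)
  rintro d ⟨T, rfl⟩
  exact triangleDelta_le hG hc3 hc T

end MG3

section MG4
set_option linter.unusedSectionVars false

/-- Basic (oriented) adjacency of the model graph on `ℕ`. -/
def gadj0 (c p q x y : ℕ) : Prop :=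
  (y = x + 1 ∧ y < c + p - 1) ∨ (x = 0 ∧ y = c - 1) ∨ (x = q - 1 ∧ y = c + p - 2) ∨
    (x = 0 ∧ c + p - 1 ≤ y)

/-- Adjacency of the model graph on `ℕ`. -/
def gadj (c p q x y : ℕ) : Prop := x ≠ y ∧ (gadj0 c p q x y ∨ gadj0 c p q y x)

/-- The model graph. -/
def modelG (c p q n : ℕ) : SimpleGraph (Fin n) where
  Adj x y := gadj c p q x y
  symm := ⟨fun _ _ h => ⟨h.1.symm, h.2.symm⟩⟩
  loopless := ⟨fun _ h => h.1 rfl⟩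

theorem chain_up {T : ℕ → Prop} {a b i : ℕ} (h : ∀ i, a ≤ i → i < b → T i → T (i + 1))
    (hi : a ≤ i) (hT : T i) : ∀ j, i ≤ j → j ≤ b → T j := by
  intro j hij
  induction j, hij using Nat.le_induction with
  | base => intro _; exact hT
  | succ j hj ih => intro hb; exact h j (by omega) (by omega) (ih (by omega))

theorem chain_down {T : ℕ → Prop} {a b i : ℕ} (h : ∀ i, a < i → i ≤ b → T i → T (i - 1))
    (hi : i ≤ b) (hT : T i) : ∀ j, a ≤ j → j ≤ i → T j := by
  have : ∀ k, a + k ≤ i → T (i - k) := by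
    intro k
    induction k with
    | zero => intro _; exact hT
    | succ k ih =>
      intro hk
      have := h (i - k) (by omega) (by omega) (ih (by omega))
      rwa [Nat.sub_sub] at this
  intro j h1 h2
  have := this (i - j) (by omega)
  rwa [Nat.sub_sub_self h2] at this

/-- A `2`-regular symmetric relation. -/
structure TwoReg (E : ℕ → ℕ → Prop) : Prop where
  symm : ∀ x y, E x y → E y x
  two : ∀ v u, E v u → ∃ x y, x ≠ y ∧ E v x ∧ E v y ∧ ∀ w, E v w → w = x ∨ w = y

theorem TwoReg.deg2 {E : ℕ → ℕ → Prop} (hE : TwoReg E) {v a b u : ℕ}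
    (h : ∀ w, E v w → w = a ∨ w = b) (hu : E v u) : E v a ∧ E v b := by
  obtain ⟨x, y, hxy, hx, hy, -⟩ := hE.two v u hu
  rcases h x hx with rfl | rfl <;> rcases h y hy with rfl | rfl
  · exact absurd rfl hxy
  · exact ⟨hx, hy⟩
  · exact ⟨hy, hx⟩
  · exact absurd rfl hxy

theorem TwoReg.no_leaf {E : ℕ → ℕ → Prop} (hE : TwoReg E) {c p q : ℕ} (hp : 1 ≤ p) (hc : 3 ≤ c)
    (hq : 1 ≤ q) (hqc : q ≤ c)
    (hadj : ∀ x y, E x y → gadj c p q x y) {u v : ℕ} (h : E u v) : u < c + p - 1 ∧ v < c + p - 1 := by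
  have key : ∀ u v, E u v → u < c + p - 1 := by
    intro u v h
    by_contra hu
    obtain ⟨x, y, hxy, hx, hy, -⟩ := hE.two u v h
    have h1 := hadj _ _ hx
    have h2 := hadj _ _ hy
    unfold gadj gadj0 at h1 h2
    omega
  exact ⟨key u v h, key v u (hE.symm _ _ h)⟩

section main
variable {E : ℕ → ℕ → Prop} {c p q : ℕ}

theorem model_A (hE : TwoReg E) (hp : 1 ≤ p) (hpq : p ≤ q) (hqc : 2 * q ≤ c) (hq : 2 ≤ q) 
    (hadj : ∀ x y, E x y → gadj c p q x y) :
    (∀ u, E 0 u → E 0 1 ∧ E 0 (c - 1)) ∧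
    (∀ i u, 1 ≤ i → i + 2 ≤ q → E i u → E i (i - 1) ∧ E i (i + 1)) := by
  have L := fun {u v} (h : E u v) => hE.no_leaf hp (by omega) (by omega) (by omega) hadj h
  refine ⟨fun u h => hE.deg2 (fun w hw => ?_) h, fun i u h1 h2 h => hE.deg2 (fun w hw => ?_) h⟩
  · have h1 := hadj _ _ hw
    have := L hw
    unfold gadj gadj0 at h1
    omega
  · have h1 := hadj _ _ hw
    have := L hw
    unfold gadj gadj0 at h1
    omega

theorem model_B (hE : TwoReg E) (hp : 1 ≤ p) (hpq : p ≤ q) (hqc : 2 * q ≤ c) (hq : 2 ≤ q) 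
    (hadj : ∀ x y, E x y → gadj c p q x y) :
    (∀ i u, q ≤ i → i + 2 ≤ c → E i u → E i (i - 1) ∧ E i (i + 1)) := by
  have L := fun {u v} (h : E u v) => hE.no_leaf hp (by omega) (by omega) (by omega) hadj h
  refine fun i u h1 h2 h => hE.deg2 (fun w hw => ?_) h
  have h1 := hadj _ _ hw
  have := L hw
  unfold gadj gadj0 at h1
  omega

theorem model_C (hE : TwoReg E) (hp : 1 ≤ p) (hpq : p ≤ q) (hqc : 2 * q ≤ c) (hq : 2 ≤ q) 
    (hadj : ∀ x y, E x y → gadj c p q x y) :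
    (∀ i u, c ≤ i → i + 2 < c + p → E i u → E i (i - 1) ∧ E i (i + 1)) ∧
    (∀ u, 2 ≤ p → E (c + p - 2) u → E (c + p - 2) (c + p - 3) ∧ E (c + p - 2) (q - 1)) := by
  have L := fun {u v} (h : E u v) => hE.no_leaf hp (by omega) (by omega) (by omega) hadj h
  refine ⟨fun i u h1 h2 h => hE.deg2 (fun w hw => ?_) h, fun u h2 h => hE.deg2 (fun w hw => ?_) h⟩
  · have h1 := hadj _ _ hw
    have := L hw
    unfold gadj gadj0 at h1
    omega
  · have h1 := hadj _ _ hw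
    have := L hw
    unfold gadj gadj0 at h1
    omega

theorem model_arms (hE : TwoReg E) (hp : 1 ≤ p) (hpq : p ≤ q) (hqc : 2 * q ≤ c) (hq : 2 ≤ q) 
    (hadj : ∀ x y, E x y → gadj c p q x y) {T : ℕ → Prop} (hT : ∀ v, T v ↔ ∃ u, E v u) :
    (∀ i, i + 2 ≤ q → T i → (∀ j, j < q → T j) ∧ T (c - 1)) ∧
    (∀ i, q ≤ i → i + 2 ≤ c → T i → (∀ j, q - 1 ≤ j → j < c → T j)) ∧
    (∀ i, c ≤ i → i < c + p - 1 → T i → (∀ j, c - 1 ≤ j → j < c + p - 1 → T j) ∧ T (q - 1)) := by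
  have T1 : ∀ {u v}, E u v → T u := fun {u v} h => (hT _).2 ⟨_, h⟩
  have T2 : ∀ {u v}, E u v → T v := fun {u v} h => (hT _).2 ⟨_, hE.symm _ _ h⟩
  obtain ⟨A0, A⟩ := model_A hE hp hpq hqc hq hadj
  have B := model_B hE hp hpq hqc hq hadj
  obtain ⟨C, C0⟩ := model_C hE hp hpq hqc hq hadj
  refine ⟨fun i hi h => ?_, fun i hi1 hi2 h => ?_, fun i hi1 hi2 h => ?_⟩
  · have up : ∀ i, 0 ≤ i → i < q - 1 → T i → T (i + 1) := by
      intro i _ hi h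
      obtain ⟨u, hu⟩ := (hT i).1 h
      rcases Nat.eq_zero_or_pos i with rfl | h0
      · exact T2 (A0 u hu).1
      · exact T2 (A i u h0 (by omega) hu).2
    have dn : ∀ i, 0 < i → i ≤ q - 2 → T i → T (i - 1) := by
      intro i h0 hi h
      obtain ⟨u, hu⟩ := (hT i).1 h
      exact T2 (A i u h0 (by omega) hu).1
    have t0 := chain_down dn (by omega) h 0 le_rfl (Nat.zero_le _)
    refine ⟨fun j hj => chain_up up le_rfl t0 j (Nat.zero_le _) (by omega), ?_⟩
    obtain ⟨u, hu⟩ := (hT 0).1 t0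
    exact T2 (A0 u hu).2
  · have up : ∀ i, q ≤ i → i < c - 1 → T i → T (i + 1) := by
      intro i h0 hi h
      obtain ⟨u, hu⟩ := (hT i).1 h
      exact T2 (B i u h0 (by omega) hu).2
    have dn : ∀ i, q - 1 < i → i ≤ c - 2 → T i → T (i - 1) := by
      intro i h0 hi h
      obtain ⟨u, hu⟩ := (hT i).1 h
      exact T2 (B i u (by omega) (by omega) hu).1
    intro j h1 h2
    rcases le_total i j with h' | h'
    · exact chain_up up hi1 h j h' (by omega)
    · exact chain_down dn (by omega) h j h1 h'
  · have up : ∀ i, c ≤ i → i < c + p - 2 → T i → T (i + 1) := by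
      intro i h0 hi h
      obtain ⟨u, hu⟩ := (hT i).1 h
      exact T2 (C i u h0 (by omega) hu).2
    have dn : ∀ i, c - 1 < i → i ≤ c + p - 2 → T i → T (i - 1) := by
      intro i h0 hi h
      obtain ⟨u, hu⟩ := (hT i).1 h
      rcases eq_or_lt_of_le hi with rfl | h'
      · exact T2 (C0 u (by omega) hu).1
      · exact T2 (C i u (by omega) (by omega) hu).1
    have t1 := chain_up up hi1 h (c + p - 2) (by omega) le_rfl
    refine ⟨fun j h1 h2 => chain_down dn le_rfl t1 j h1 (by omega), ?_⟩
    obtain ⟨u, hu⟩ := (hT _).1 t1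
    exact T2 (C0 u (by omega) hu).2

theorem model_lower (hE : TwoReg E) (hp : 1 ≤ p) (hpq : p ≤ q) (hqc : 2 * q ≤ c) (hq : 2 ≤ q) 
    (hadj : ∀ x y, E x y → gadj c p q x y) (S : Finset ℕ) (hS : ∀ v, v ∈ S ↔ ∃ u, E v u)
    (hne : S.Nonempty) : p + q ≤ S.card := by
  have L := fun {u v} (h : E u v) => hE.no_leaf hp (by omega) (by omega) (by omega) hadj h
  have T2 : ∀ {u v}, E u v → v ∈ S := fun {u v} h => (hS _).2 ⟨_, hE.symm _ _ h⟩
  obtain ⟨A, B, C⟩ := model_arms hE hp hpq hqc hq hadj hS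
  have hc1 : c - 1 ∈ S := by
    obtain ⟨v, hv⟩ := hne
    obtain ⟨u, hu⟩ := (hS v).1 hv
    have := L hu
    by_cases h1 : v + 2 ≤ q
    · exact (A v h1 hv).2
    by_cases h2 : q ≤ v ∧ v + 2 ≤ c
    · exact B v h2.1 h2.2 hv _ (by omega) (by omega)
    by_cases h3 : c ≤ v
    · exact (C v h3 (by omega) hv).1 _ le_rfl (by omega)
    by_cases h4 : v = c - 1
    · rwa [← h4]
    have h5 : v = q - 1 := by omega
    subst h5
    obtain ⟨x, y, hxy, hx, hy, -⟩ := hE.two _ u hu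
    have h1 := hadj _ _ hx
    have h2 := hadj _ _ hy
    have : (x = q - 2 ∨ x = q) ∨ (y = q - 2 ∨ y = q) := by
      unfold gadj gadj0 at h1 h2
      omega
    rcases this with (h | h) | (h | h)
    · exact (A x (by omega) (T2 hx)).2
    · exact B x (by omega) (by omega) (T2 hx) _ (by omega) (by omega)
    · exact (A y (by omega) (T2 hy)).2
    · exact B y (by omega) (by omega) (T2 hy) _ (by omega) (by omega)
  obtain ⟨u, hu⟩ := (hS _).1 hc1
  obtain ⟨x, y, hxy, hx, hy, -⟩ := hE.two _ u hu
  have h1 := hadj _ _ hx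
  have h2 := hadj _ _ hy
  have cls : ∀ x, E (c - 1) x → x = 0 ∨ x = c - 2 ∨ (x ≠ 0 ∧ x ≠ c - 2 ∧
      q - 1 ∈ S ∧ ∀ j, c - 1 ≤ j → j < c + p - 1 → j ∈ S) := by
    intro x hx
    have h1 := hadj _ _ hx
    have h2 := L hx
    have : x = 0 ∨ x = c - 2 ∨ (p = 1 ∧ x = q - 1) ∨ (2 ≤ p ∧ x = c) := by
      unfold gadj gadj0 at h1
      omega
    by_cases e1 : x = 0
    · exact Or.inl e1
    by_cases e2 : x = c - 2
    · exact Or.inr (Or.inl e2)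
    refine Or.inr (Or.inr ⟨e1, e2, ?_⟩)
    rcases this with h | h | ⟨hp1, rfl⟩ | ⟨hp1, rfl⟩
    · exact absurd h e1
    · exact absurd h e2
    · refine ⟨T2 hx, fun j h1 h2 => ?_⟩
      rwa [show j = c - 1 by omega]
    · obtain ⟨r, s⟩ := C x le_rfl (by omega) (T2 hx)
      exact ⟨s, r⟩
  have AB : 0 ∈ S → c - 2 ∈ S → p + q ≤ S.card := by
    intro a b
    have hsub : Finset.range c ⊆ S := by
      intro j hj
      rw [Finset.mem_range] at hj
      by_cases h : j < q
      · exact (A 0 (by omega) a).1 j h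
      · exact B (c - 2) (by omega) (by omega) b j (by omega) (by omega)
    have := Finset.card_le_card hsub
    rw [Finset.card_range] at this
    omega
  have AC : 0 ∈ S → (∀ j, c - 1 ≤ j → j < c + p - 1 → j ∈ S) → p + q ≤ S.card := by
    intro a b
    have hsub : Finset.range q ∪ Finset.Ico (c - 1) (c + p - 1) ⊆ S := by
      intro j hj
      rw [Finset.mem_union, Finset.mem_range, Finset.mem_Ico] at hj
      rcases hj with h | h
      · exact (A 0 (by omega) a).1 j h
      · exact b j h.1 h.2
    have := Finset.card_le_card hsub
    rw [Finset.card_union_of_disjoint, Finset.card_range, Nat.card_Ico] at this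
    · omega
    · rw [Finset.disjoint_left]
      intro j h1 h2
      rw [Finset.mem_range] at h1
      rw [Finset.mem_Ico] at h2
      omega
  have BC : c - 2 ∈ S → (∀ j, c - 1 ≤ j → j < c + p - 1 → j ∈ S) → p + q ≤ S.card := by
    intro a b
    have hsub : Finset.Ico (q - 1) (c + p - 1) ⊆ S := by
      intro j hj
      rw [Finset.mem_Ico] at hj
      by_cases h : j < c
      · exact B (c - 2) (by omega) (by omega) a j (by omega) (by omega)
      · exact b j (by omega) (by omega)
    have := Finset.card_le_card hsub
    rw [Nat.card_Ico] at this
    omega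
  have tx := T2 hx
  have ty := T2 hy
  rcases cls x hx with rfl | rfl | ⟨x1, x2, x3, x4⟩ <;> rcases cls y hy with rfl | rfl | ⟨y1, y2, y3, y4⟩
  · exact absurd rfl hxy
  · exact AB tx ty
  · exact AC tx y4
  · exact AB ty tx
  · exact absurd rfl hxy
  · exact BC tx y4
  · exact AC ty x4
  · exact BC ty x4
  · exfalso
    have := L hx
    have := L hy
    unfold gadj gadj0 at h1 h2
    omega

theorem model_upper (hE : TwoReg E) (hp : 1 ≤ p) (hpq : p ≤ q) (hqc : 2 * q ≤ c) (hq : 2 ≤ q) 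
    (hadj : ∀ x y, E x y → gadj c p q x y) (S : Finset ℕ) (hS : ∀ v, v ∈ S ↔ ∃ u, E v u) :
    S.card ≤ c := by
  have L := fun {u v} (h : E u v) => hE.no_leaf hp (by omega) (by omega) (by omega) hadj h
  obtain ⟨A, B, C⟩ := model_arms hE hp hpq hqc hq hadj hS
  have hN : ∀ v ∈ S, v < c + p - 1 := by
    intro v hv
    obtain ⟨u, hu⟩ := (hS v).1 hv
    exact (L hu).1
  have bound : ∀ a b, a ≤ b → b ≤ c + p - 1 → p - 1 ≤ b - a → (∀ i, a ≤ i → i < b → i ∉ S) →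
      S.card ≤ c := by
    intro a b hab hb hl h
    have hsub : S ⊆ Finset.range (c + p - 1) \ Finset.Ico a b := by
      intro v hv
      rw [Finset.mem_sdiff, Finset.mem_range, Finset.mem_Ico]
      exact ⟨hN v hv, fun h' => h v h'.1 h'.2 hv⟩
    have := Finset.card_le_card hsub
    rw [Finset.card_sdiff_of_subset, Finset.card_range, Nat.card_Ico] at this
    · omega
    · intro v hv
      rw [Finset.mem_Ico] at hv
      rw [Finset.mem_range]
      omega
  rcases eq_or_lt_of_le hp with rfl | hp2
  · exact bound 0 0 le_rfl (by omega) (by omega) (fun i _ h => by omega)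
  by_cases a : 0 ∈ S
  swap
  · refine bound 0 (q - 1) (by omega) (by omega) (by omega) (fun i _ h hi => a ?_)
    exact (A i (by omega) hi).1 0 (by omega)
  by_cases b : c - 2 ∈ S
  swap
  · refine bound q (c - 1) (by omega) (by omega) (by omega) (fun i h1 h hi => b ?_)
    exact B i h1 (by omega) hi _ (by omega) (by omega)
  by_cases d : c ∈ S
  swap
  · refine bound c (c + p - 1) (by omega) (by omega) (by omega) (fun i h1 h hi => d ?_)
    exact (C i h1 (by omega) hi).1 _ (by omega) (by omega)
  exfalso
  obtain ⟨u, hu⟩ := (hS _).1 a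
  have e1 := hE.symm _ _ ((model_A hE hp hpq hqc hq hadj).1 u hu).2
  obtain ⟨u, hu⟩ := (hS _).1 b
  have e2 := (model_B hE hp hpq hqc hq hadj _ u (by omega) (by omega) hu).2
  rw [show c - 2 + 1 = c - 1 by omega] at e2
  have e2 := hE.symm _ _ e2
  obtain ⟨u, hu⟩ := (hS _).1 d
  have e3 : E (c - 1) c := by
    apply hE.symm
    by_cases hp' : p = 2
    · subst hp'
      exact ((model_C hE hp hpq hqc hq hadj).2 u le_rfl hu).1
    · exact ((model_C hE hp hpq hqc hq hadj).1 c u le_rfl (by omega) hu).1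
  obtain ⟨x, y, -, -, -, h⟩ := hE.two _ _ e1
  have h1 := h _ e1
  have h2 := h _ e2
  have h3 := h _ e3
  omega

/-- The plain cycle: every `2`-regular piece is everything. -/
theorem model_cycle (hE : TwoReg E) (hc : 3 ≤ c)
    (hadj : ∀ x y, E x y → gadj c 1 c x y) (S : Finset ℕ) (hS : ∀ v, v ∈ S ↔ ∃ u, E v u)
    (hne : S.Nonempty) : S.card = c := by
  have L := fun {u v} (h : E u v) => hE.no_leaf le_rfl hc (by omega) (by omega) hadj h
  have T2 : ∀ {u v}, E u v → v ∈ S := fun {u v} h => (hS _).2 ⟨_, hE.symm _ _ h⟩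
  have : S = Finset.range c := by
    apply Finset.Subset.antisymm
    · intro v hv
      obtain ⟨u, hu⟩ := (hS v).1 hv
      rw [Finset.mem_range]
      have := L hu
      omega
    · obtain ⟨v, hv⟩ := hne
      have dn : ∀ i, 0 < i → i ≤ c - 1 → i ∈ S → i - 1 ∈ S := by
        intro i h0 h1 hi
        obtain ⟨u, hu⟩ := (hS _).1 hi
        have := hE.deg2 (v := i) (a := i - 1) (b := if i = c - 1 then 0 else i + 1) (fun w hw => by
          have h1 := hadj _ _ hw
          have := L hw
          unfold gadj gadj0 at h1
          split_ifs <;> omega) hu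
        exact T2 this.1
      have up : ∀ i, 0 ≤ i → i < c - 1 → i ∈ S → i + 1 ∈ S := by
        intro i h0 h1 hi
        obtain ⟨u, hu⟩ := (hS _).1 hi
        have := hE.deg2 (v := i) (a := i + 1) (b := if i = 0 then c - 1 else i - 1) (fun w hw => by
          have h1 := hadj _ _ hw
          have := L hw
          unfold gadj gadj0 at h1
          split_ifs <;> omega) hu
        exact T2 this.1
      intro j hj
      rw [Finset.mem_range] at hj
      obtain ⟨u, hu⟩ := (hS v).1 hv
      have h1 := L hu
      have t0 := chain_down dn (by omega) hv 0 le_rfl (Nat.zero_le _)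
      exact chain_up up le_rfl t0 j (Nat.zero_le _) (by omega)
  rw [this, Finset.card_range]

end main
end MG4

section MG5
set_option linter.unusedSectionVars false

theorem exists_cycle_of_seq {V : Type} {G : SimpleGraph V} {m : ℕ} (hm : 3 ≤ m) (f : ℕ → V)
    (hinj : ∀ i j, i < m → j < m → f i = f j → i = j)
    (hadj : ∀ i, i + 1 < m → G.Adj (f i) (f (i + 1))) (hcl : G.Adj (f (m - 1)) (f 0)) :
    ∃ (v : V) (p : G.Walk v v), p.IsCycle ∧ p.length = m := by
  rw [← cycleGraph_isContained_iff (by omega)]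
  have key : ∀ u v : Fin m, (u - v).val = 1 → G.Adj (f v) (f u) := by
    intro u v h
    rcases le_or_gt v u with hle | hlt
    · rw [Fin.sub_val_of_le hle] at h
      have e : u.val = v.val + 1 := by
        have : v.val ≤ u.val := hle
        omega
      rw [e]
      exact hadj _ (by omega)
    · have h' := Fin.coe_sub_iff_lt.2 hlt
      have h1 : u.val < v.val := hlt
      have h2 := v.2
      rw [show (v : ℕ) = m - 1 by omega, show (u : ℕ) = 0 by omega]
      exact hcl
  refine ⟨⟨⟨fun i => f i, ?_⟩, ?_⟩⟩
  · intro u v h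
    rcases cycleGraph_adj'.1 h with h | h
    · exact (key _ _ h).symm
    · exact key _ _ h
  · intro u v h
    exact Fin.ext (hinj _ _ u.2 v.2 h)

/-- The edge relation of a cycle, transported to `ℕ`. -/
def cycE {n : ℕ} {G : SimpleGraph (Fin n)} {a : Fin n} (w : G.Walk a a) (i j : ℕ) : Prop :=
  ∃ (x y : Fin n), x.val = i ∧ y.val = j ∧ w.toSubgraph.Adj x y

theorem cycE_twoReg {n : ℕ} {G : SimpleGraph (Fin n)} {a : Fin n} {w : G.Walk a a}
    (hw : w.IsCycle) : TwoReg (cycE w) := by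
  constructor
  · rintro _ _ ⟨x, y, rfl, rfl, h⟩
    exact ⟨y, x, rfl, rfl, h.symm⟩
  · rintro _ _ ⟨x, y, rfl, rfl, h⟩
    have hx : x ∈ w.support := by
      rw [← Walk.mem_verts_toSubgraph]
      exact h.fst_mem
    have := hw.ncard_neighborSet_toSubgraph_eq_two hx
    obtain ⟨s, t, hst, e⟩ := Set.ncard_eq_two.1 this
    have hs : s ∈ w.toSubgraph.neighborSet x := by rw [e]; simp
    have ht : t ∈ w.toSubgraph.neighborSet x := by rw [e]; simp
    refine ⟨s, t, fun h => hst (Fin.ext h), ⟨x, s, rfl, rfl, hs⟩, ⟨x, t, rfl, rfl, ht⟩, ?_⟩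
    rintro _ ⟨x', y', hx', rfl, h'⟩
    have : x' = x := Fin.ext hx'
    subst this
    have : y' ∈ w.toSubgraph.neighborSet x' := h'
    rw [e] at this
    rcases this with rfl | rfl
    · exact Or.inl rfl
    · exact Or.inr rfl

theorem cycle_supp {V : Type} [DecidableEq V] {G : SimpleGraph V} {a : V} {w : G.Walk a a}
    (hw : w.IsCycle) : w.support.toFinset.card = w.length := by
  have h : w.support.toFinset = w.support.tail.toFinset := by
    ext v
    rw [List.mem_toFinset, List.mem_toFinset]
    constructor
    · intro h
      rw [Walk.mem_support_iff] at h
      rcases h with rfl | h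
      · exact Walk.end_mem_tail_support hw.not_nil
      · exact h
    · exact List.mem_of_mem_tail
  rw [h, List.toFinset_card_of_nodup hw.support_nodup]
  simp

theorem cycE_supp {n : ℕ} {G : SimpleGraph (Fin n)} {a : Fin n} {w : G.Walk a a}
    (hw : w.IsCycle) : ∃ S : Finset ℕ, (∀ v, v ∈ S ↔ ∃ u, cycE w v u) ∧ S.Nonempty ∧
      S.card = w.length := by
  refine ⟨w.support.toFinset.map Fin.valEmbedding, ?_, ?_, ?_⟩
  · intro v
    simp only [Finset.mem_map, List.mem_toFinset, Fin.valEmbedding_apply]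
    constructor
    · rintro ⟨x, hx, rfl⟩
      have := hw.ncard_neighborSet_toSubgraph_eq_two hx
      obtain ⟨s, t, hst, e⟩ := Set.ncard_eq_two.1 this
      have hs : s ∈ w.toSubgraph.neighborSet x := by rw [e]; simp
      exact ⟨s, x, s, rfl, rfl, hs⟩
    · rintro ⟨_, x, y, rfl, rfl, h⟩
      refine ⟨x, ?_, rfl⟩
      rw [← Walk.mem_verts_toSubgraph]
      exact h.fst_mem
  · exact Finset.Nonempty.map ⟨a, by simp⟩
  · rw [Finset.card_map, cycle_supp hw]

theorem cycE_adj {c p q n : ℕ} {a : Fin n} (w : (modelG c p q n).Walk a a) :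
    ∀ x y, cycE w x y → gadj c p q x y := by
  rintro _ _ ⟨x, y, rfl, rfl, h⟩
  exact h.adj_sub

theorem modelG_bounds {c p q n : ℕ} (hp : 1 ≤ p) (hpq : p ≤ q) (hqc : 2 * q ≤ c) (hq : 2 ≤ q)
    {a : Fin n} {w : (modelG c p q n).Walk a a} (hw : w.IsCycle) :
    p + q ≤ w.length ∧ w.length ≤ c := by
  obtain ⟨S, h1, h2, h3⟩ := cycE_supp hw
  rw [← h3]
  exact ⟨model_lower (cycE_twoReg hw) hp hpq hqc hq (cycE_adj w) S h1 h2,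
    model_upper (cycE_twoReg hw) hp hpq hqc hq (cycE_adj w) S h1⟩

theorem modelG_bounds' {c n : ℕ} (hc : 3 ≤ c)
    {a : Fin n} {w : (modelG c 1 c n).Walk a a} (hw : w.IsCycle) : w.length = c := by
  obtain ⟨S, h1, h2, h3⟩ := cycE_supp hw
  rw [← h3]
  exact model_cycle (cycE_twoReg hw) hc (cycE_adj w) S h1 h2

theorem modelG_connected {c p q n : ℕ} (hc : 3 ≤ c) (hp : 1 ≤ p) (hn : c + p - 1 ≤ n) :
    (modelG c p q n).Connected := by
  have h0 : 0 < n := by omega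
  have key : ∀ k (hk : k < n), (modelG c p q n).Reachable ⟨0, h0⟩ ⟨k, hk⟩ := by
    intro k
    induction k with
    | zero => intro _; exact Reachable.refl _
    | succ k ih =>
      intro hk
      by_cases h : k + 1 < c + p - 1
      · refine (ih (by omega)).trans (Adj.reachable ?_)
        exact ⟨by simp, Or.inl (Or.inl ⟨rfl, h⟩)⟩
      · apply Adj.reachable
        exact ⟨by simp, Or.inl (Or.inr (Or.inr (Or.inr ⟨rfl, by simp; omega⟩)))⟩
  have : Nonempty (Fin n) := ⟨⟨0, h0⟩⟩
  exact Connected.mk (fun u v => (key u u.2).symm.trans (key v v.2))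

theorem modelG_cycle_c {c p q n : ℕ} (hc : 3 ≤ c) (hp : 1 ≤ p) (hn : c + p - 1 ≤ n) :
    ∃ (v : Fin n) (w : (modelG c p q n).Walk v v), w.IsCycle ∧ w.length = c := by
  have h0 : 0 < n := by omega
  have e : ∀ i, i < c → i % n = i := fun i hi => Nat.mod_eq_of_lt (by omega)
  apply exists_cycle_of_seq hc (fun i => (⟨i % n, Nat.mod_lt _ h0⟩ : Fin n))
  · intro i j hi hj h
    simp only [Fin.mk.injEq] at h
    rwa [e i hi, e j hj] at h
  · intro i hi
    show gadj _ _ _ (i % n) ((i + 1) % n)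
    rw [e i (by omega), e (i + 1) (by omega)]
    unfold gadj gadj0
    omega
  · show gadj _ _ _ ((c - 1) % n) (0 % n)
    rw [e _ (by omega), e _ (by omega)]
    unfold gadj gadj0
    omega

theorem modelG_cycle_g {c p q n : ℕ} (hp : 1 ≤ p) (hpq : p ≤ q) (hqc : 2 * q ≤ c) (hq : 2 ≤ q)
    (hn : c + p - 1 ≤ n) :
    ∃ (v : Fin n) (w : (modelG c p q n).Walk v v), w.IsCycle ∧ w.length = p + q := by
  have h0 : 0 < n := by omega
  have e : ∀ i, i < c + p - 1 → i % n = i := fun i hi => Nat.mod_eq_of_lt (by omega)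
  let f : ℕ → ℕ := fun k => if k < q then q - 1 - k else c - 1 + (k - q)
  have hf : ∀ k, f k = if k < q then q - 1 - k else c - 1 + (k - q) := fun _ => rfl
  have hb : ∀ k, k < p + q → f k < c + p - 1 := by
    intro k hk
    rw [hf]
    split_ifs <;> omega
  apply exists_cycle_of_seq (by omega) (fun i => (⟨f i % n, Nat.mod_lt _ h0⟩ : Fin n))
  · intro i j hi hj h
    simp only [Fin.mk.injEq] at h
    rw [e _ (hb i hi), e _ (hb j hj)] at h
    rw [hf, hf] at h
    split_ifs at h <;> omega
  · intro i hi
    show gadj _ _ _ (f i % n) (f (i + 1) % n)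
    rw [e _ (hb i (by omega)), e _ (hb (i + 1) (by omega)), hf, hf]
    unfold gadj gadj0
    split_ifs <;> omega
  · show gadj _ _ _ (f (p + q - 1) % n) (f 0 % n)
    rw [e _ (hb _ (by omega)), e _ (hb _ (by omega)), hf, hf]
    unfold gadj gadj0
    split_ifs <;> omega

theorem memGclass_of {g c n : ℕ} {G : SimpleGraph (Fin n)} (hG : G.Connected) 
    (hb : ∀ (a : Fin n) (w : G.Walk a a), w.IsCycle → g ≤ w.length ∧ w.length ≤ c)
    (hg : ∃ (v : Fin n) (w : G.Walk v v), w.IsCycle ∧ w.length = g)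
    (hc : ∃ (v : Fin n) (w : G.Walk v v), w.IsCycle ∧ w.length = c) : memGclass g c G := by
  refine ⟨hG, ?_, ?_⟩
  · obtain ⟨v, w, hw, rfl⟩ := hg
    apply le_antisymm (hw.girth_le_length)
    have : ¬ G.IsAcyclic := fun h => h w hw
    obtain ⟨a, w', hw', e⟩ := exists_girth_eq_length.2 this
    rw [e]
    exact (hb a w' hw').1
  · obtain ⟨v, w, hw, rfl⟩ := hc
    apply le_antisymm _ (length_le_circumference hw)
    unfold circumference
    refine csSup_le ⟨w.length, v, w, hw, rfl⟩ ?_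
    rintro _ ⟨a, w', hw', rfl⟩
    exact (hb a w' hw').2

noncomputable def extH (c p q : ℕ) (C : ℝ → ℝ) (w : ℕ) : ℝ :=
  if w < c then C w else if w < c + p - 1 then
    max (C (c - 1) - (w - (c - 1))) (C (q - 1) - (c + p - 1 - w)) else C 0

theorem extH_lip {c p q : ℕ} (hc : 3 ≤ c) (hp : 1 ≤ p) (hq : 1 ≤ q) (hqc : q ≤ c) {C : ℝ → ℝ}
    (hC : ∀ x y, |C x - C y| ≤ |x - y|) (hper : C c = C 0) (hpq : |C (c - 1) - C (q - 1)| ≤ p)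
    (u v : ℕ) (h : gadj c p q u v) : extH c p q C u - extH c p q C v ≤ 1 := by
  have N : ((c + p - 1 : ℕ) : ℝ) = c + p - 1 := by
    rw [Nat.cast_sub (by omega)]; push_cast; ring
  have hformula : ∀ w : ℕ, c - 1 ≤ w → w < c + p - 1 → extH c p q C w =
      max (C (c - 1) - (w - (c - 1))) (C (q - 1) - (c + p - 1 - w)) := by
    intro w h1 h2
    unfold extH
    split_ifs with h
    · have : w = c - 1 := by omega
      have e : (w : ℝ) = c - 1 := by
        rw [this, Nat.cast_sub (by omega)]; simp
      rw [e, max_eq_left]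
      · ring
      · have := (abs_le.1 hpq).1
        linarith
    · rfl
  have hlow : ∀ w : ℕ, w < c → extH c p q C w = C w := by
    intro w h; unfold extH; rw [if_pos h]
  have hleaf : ∀ w : ℕ, c + p - 1 ≤ w → extH c p q C w = C 0 := by
    intro w h; unfold extH; rw [if_neg (by omega), if_neg (by omega)]
  have key : ∀ x y, gadj0 c p q x y → x ≠ y → |extH c p q C x - extH c p q C y| ≤ 1 := by
    intro x y h hxy
    rcases h with ⟨rfl, h⟩ | ⟨rfl, rfl⟩ | ⟨rfl, rfl⟩ | ⟨rfl, h⟩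
    · by_cases h' : x + 1 < c
      · rw [hlow _ h', hlow _ (by omega)]
        refine (hC _ _).trans ?_
        push_cast
        rw [abs_le]; constructor <;> linarith
      · rw [hformula _ (by omega) h, hformula x (by omega) (by omega)]
        refine (abs_max_sub_max_le_max _ _ _ _).trans ?_
        push_cast
        apply max_le <;> rw [abs_le] <;> constructor <;> linarith
    · rw [hlow _ (by omega), hlow _ (by omega)]
      rw [Nat.cast_zero, ← hper]
      refine (hC _ _).trans ?_
      rw [Nat.cast_sub (by omega)]
      push_cast
      rw [abs_le]; constructor <;> linarith
    · rw [hlow _ (by omega), hformula _ (by omega) (by omega)]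
      have h1 := abs_le.1 hpq
      have e1 : ((q - 1 : ℕ) : ℝ) = q - 1 := by rw [Nat.cast_sub hq]; simp
      have e2 : ((c + p - 2 : ℕ) : ℝ) = c + p - 2 := by rw [Nat.cast_sub (by omega)]; simp
      rw [e1, e2]
      rw [abs_le]
      have m1 := le_max_right (C (c - 1) - ((c + p - 2 : ℝ) - (c - 1)))
        (C (q - 1) - (c + p - 1 - (c + p - 2 : ℝ)))
      constructor
      · have : max (C (c - 1) - ((c + p - 2 : ℝ) - (c - 1)))
          (C (q - 1) - (c + p - 1 - (c + p - 2 : ℝ))) ≤ C (q - 1) + 1 := by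
          apply max_le <;> linarith
        linarith
      · linarith
    · rw [hlow _ (by omega), hleaf _ h]
      simp
  obtain ⟨hne, h | h⟩ := h
  · exact (abs_le.1 (key _ _ h hne)).2
  · have := (abs_le.1 (key _ _ h hne.symm)).1
    linarith

theorem modelG_hyp {c p q n : ℕ} (hc : 3 ≤ c) (hp : 1 ≤ p) (hq : 1 ≤ q) (hqc : q ≤ c)
    (hn : c + p - 1 ≤ n)
    (hcyc : ∀ (a : Fin n) (w : (modelG c p q n).Walk a a), w.IsCycle → w.length ≤ c) (θ : ℝ)
    (h0 : |cD c (c - 1 - θ) - cD c (q - 1 - θ)| ≤ p)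
    (h1 : |min ((c : ℝ) / 4) (cD c (c - 1 - θ - c / 4)) -
      min ((c : ℝ) / 4) (cD c (q - 1 - θ - c / 4))| ≤ p) :
    (c : ℝ) / 4 ≤ hypDelta (modelG c p q n) := by
  have hc0 : 0 < c := by omega
  have hcz : (0 : ℤ) < c := by exact_mod_cast hc0
  have hlt : ∀ k : ℤ, (k % c).toNat < c := by
    intro k
    have := Int.emod_nonneg k hcz.ne'
    have := Int.emod_lt_of_pos k hcz
    omega
  let z : ℤ → Fin n := fun k => ⟨(k % c).toNat, by have := hlt k; omega⟩
  have hzv : ∀ k : ℤ, (((z k).val : ℕ) : ℤ) = k % c := by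
    intro k
    exact Int.toNat_of_nonneg (Int.emod_nonneg k hcz.ne')
  have ext : ∀ {C : ℝ → ℝ} (hper : ∀ x (m : ℤ), C (x + c * m) = C x) (k : ℤ),
      extH c p q C (z k) = C k := by
    intro C hper k
    unfold extH
    rw [if_pos (hlt k)]
    have e : (((z k).val : ℕ) : ℝ) = ((k % c : ℤ) : ℝ) := by exact_mod_cast hzv k
    rw [e, ← hper _ (k / c)]
    congr 1
    exact_mod_cast Int.emod_add_mul_ediv k c
  have P0 : ∀ x (m : ℤ), cD c (x + c * m - θ) = cD c (x - θ) := by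
    intro x m
    rw [← cD_periodic hc0 (x - θ) m]; congr 1; ring
  have P1 : ∀ x (m : ℤ), min ((c : ℝ) / 4) (cD c (x + c * m - θ - c / 4)) =
      min ((c : ℝ) / 4) (cD c (x - θ - c / 4)) := by
    intro x m
    rw [← cD_periodic hc0 (x - θ - c / 4) m]; congr 2; ring
  refine hypDelta_ge (modelG_connected hc hp hn) hc hcyc z ?_ ?_ ?_ θ
    (H0 := fun v => extH c p q (fun x => cD c (x - θ)) v)
    (H1 := fun v => extH c p q (fun x => min ((c : ℝ) / 4) (cD c (x - θ - c / 4))) v) ?_ ?_ ?_ ?_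
  · intro k
    show gadj _ _ _ (z k).val (z (k + 1)).val
    have a1 := hzv k
    have a2 := hzv (k + 1)
    have b1 := Int.emod_nonneg k hcz.ne'
    have b2 := Int.emod_lt_of_pos k hcz
    have : (k + 1) % c = if k % c = c - 1 then 0 else k % c + 1 := by
      split_ifs with h
      · rw [Int.add_emod, h]
        apply Int.emod_eq_zero_of_dvd
        exact ⟨0 + 1 - 1 % c + 1 % c - 0, by
          rw [Int.emod_eq_of_lt (by norm_num : (0 : ℤ) ≤ 1) (by omega)]; ring⟩ 
      · rw [Int.add_emod, Int.emod_eq_of_lt (by norm_num : (0 : ℤ) ≤ 1) (by omega),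
          Int.emod_eq_of_lt (by omega) (by omega)]
    rw [this] at a2
    unfold gadj gadj0
    split_ifs at a2 <;> omega
  · intro k l h
    have h' : k % c = l % c := by rw [← hzv, ← hzv, h]
    exact Int.ModEq.dvd (Int.ModEq.symm h')
  · intro k
    apply Fin.ext
    show ((k + c) % c).toNat = (k % c).toNat
    rw [Int.add_emod_right]
  · intro u v h
    refine extH_lip hc hp hq hqc ?_ ?_ ?_ _ _ h
    · intro x y
      simpa using cD_lip hc0 (x - θ) (y - θ)
    · simpa using P0 0 1
    · exact h0
  · exact ext P0
  · intro u v h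
    refine extH_lip hc hp hq hqc ?_ ?_ ?_ _ _ h
    · intro x y
      refine (abs_min_sub_min_le_max _ _ _ _).trans ?_
      simpa using cD_lip hc0 (x - θ - c / 4) (y - θ - c / 4)
    · simpa using P1 0 1
    · exact h1
  · exact ext P1

/-- Case `g = c`. -/
theorem model_eq {c n : ℕ} (hc : 3 ≤ c) (hn : c ≤ n) :
    ∃ G : SimpleGraph (Fin n), memGclass c c G ∧ (c : ℝ) / 4 ≤ hypDelta G := by
  refine ⟨modelG c 1 c n, memGclass_of (modelG_connected hc le_rfl (by omega)) ?_ ?_ ?_, ?_⟩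
  · intro a w hw
    rw [modelG_bounds' hc hw]
    exact ⟨le_rfl, le_rfl⟩
  · exact modelG_cycle_c hc le_rfl (by omega)
  · exact modelG_cycle_c hc le_rfl (by omega)
  · refine modelG_hyp hc le_rfl (by omega) le_rfl (by omega) ?_ 0 (by simp) (by simp)
    intro a w hw
    rw [modelG_bounds' hc hw]

/-- Case `g < c`. -/
theorem model_lt {c p q n : ℕ} (hp : 1 ≤ p) (hpq : p ≤ q) (hq3 : q ≤ 3 * p) (hqc : 2 * q ≤ c)
    (hq : 2 ≤ q) (hn : c + p - 1 ≤ n) :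
    ∃ G : SimpleGraph (Fin n), memGclass (p + q) c G ∧ (c : ℝ) / 4 ≤ hypDelta G := by
  have hc : 3 ≤ c := by omega
  have hc0 : 0 < c := by omega
  refine ⟨modelG c p q n, memGclass_of (modelG_connected hc hp hn) ?_ ?_ ?_, ?_⟩
  · intro a w hw
    exact modelG_bounds hp hpq hqc hq hw
  · exact modelG_cycle_g hp hpq hqc hq hn
  · exact modelG_cycle_c hc hp hn
  have rp : (1 : ℝ) ≤ p := by exact_mod_cast hp
  have rpq : (p : ℝ) ≤ q := by exact_mod_cast hpq
  have rq3 : (q : ℝ) ≤ 3 * p := by exact_mod_cast hq3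
  have rqc : 2 * (q : ℝ) ≤ c := by exact_mod_cast hqc
  refine modelG_hyp hc hp (by omega) (by omega) hn (fun a w hw => (modelG_bounds hp hpq hqc hq hw).2)
    ((p + q) / 2 - 1) ?_ ?_
  · rw [cD_eq_sub hc0 (by linarith) (by linarith), cD_eq hc0 (by rw [abs_le]; constructor <;> linarith),
      abs_of_nonneg (by linarith : (0 : ℝ) ≤ q - 1 - ((p + q) / 2 - 1)), abs_le]
    constructor <;> linarith
  · have e1 : (c : ℝ) / 4 ≤ cD c (c - 1 - ((p + q) / 2 - 1) - c / 4) := by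
      rcases le_total ((c : ℝ) / 2) (c - 1 - ((p + q) / 2 - 1) - c / 4) with h | h
      · rw [cD_eq_sub hc0 h (by linarith)]; linarith
      · rw [cD_eq hc0 (by rw [abs_le]; constructor <;> linarith), abs_of_nonneg (by linarith)]
        linarith
    rw [min_eq_left e1, cD_eq hc0 (by rw [abs_le]; constructor <;> linarith),
      abs_of_nonpos (by linarith : (q : ℝ) - 1 - ((p + q) / 2 - 1) - c / 4 ≤ 0), abs_of_nonneg (sub_nonneg.2 (min_le_left _ _)), sub_le_comm]
    apply le_min <;> linarith

end MG5

section MG6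
set_option linter.unusedSectionVars false
variable {V : Type} [Fintype V] [DecidableEq V] {G : SimpleGraph V}

theorem cycle_arc {a : V} (C : G.Walk a a) {u v : V} (hu : u ∈ C.support) (hv : v ∈ C.support) :
    ∃ w : G.Walk u v, w.edges ⊆ C.edges ∧ 2 * w.length ≤ C.length := by
  have hv' : v ∈ (C.rotate u hu).support := by
    rw [← Walk.mem_verts_toSubgraph, Walk.toSubgraph_rotate, Walk.mem_verts_toSubgraph]
    exact hv
  have hl : ((C.rotate u hu).takeUntil v hv').length + ((C.rotate u hu).dropUntil v hv').length
      = C.length := by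
    rw [← Walk.length_append, Walk.take_spec, Walk.length_rotate]
  have hsub : (C.rotate u hu).edges ⊆ C.edges := by
    intro e he
    exact (C.rotate_edges u hu).mem_iff.1 he
  by_cases h : 2 * ((C.rotate u hu).takeUntil v hv').length ≤ C.length
  · refine ⟨_, ?_, h⟩
    exact fun e he => hsub (Walk.edges_takeUntil_subset_edges _ _ he)
  · refine ⟨((C.rotate u hu).dropUntil v hv').reverse, ?_, ?_⟩
    · rw [Walk.edges_reverse]
      intro e he
      rw [List.mem_reverse] at he
      exact hsub (Walk.edges_dropUntil_subset_edges _ _ he)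
    · rw [Walk.length_reverse]
      omega

theorem cycle_edge_not_mem {a b : V} {C : G.Walk a a} (hC : C.IsCycle) {D : G.Walk b b}
    (hD : D.IsCycle) (hlt : D.length < C.length) :
    ∃ i < D.length, ¬ C.toSubgraph.Adj (D.getVert i) (D.getVert (i + 1)) := by
  by_contra! hcon
  have hsub : ∀ u v, D.toSubgraph.Adj u v → C.toSubgraph.Adj u v := by
    intro u v h
    obtain ⟨i, e, hi⟩ := (D.toSubgraph_adj_iff).1 h
    rw [← Subgraph.mem_edgeSet, ← e, Subgraph.mem_edgeSet]
    exact hcon i hi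
  have hcl : ∀ u v, u ∈ D.support → C.toSubgraph.Adj u v → v ∈ D.support := by
    intro u v hu huv
    have hn := hD.ncard_neighborSet_toSubgraph_eq_two hu
    have huC : u ∈ C.support := Walk.mem_support_of_adj_toSubgraph huv
    have hn' := hC.ncard_neighborSet_toSubgraph_eq_two huC
    have : D.toSubgraph.neighborSet u = C.toSubgraph.neighborSet u :=
      Set.eq_of_subset_of_ncard_le (fun w hw => hsub u w hw) (by omega) (Set.toFinite _)
    have h2 : v ∈ C.toSubgraph.neighborSet u := huv
    rw [← this] at h2
    exact Walk.mem_support_of_adj_toSubgraph (Subgraph.Adj.symm h2)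
  have hbC : b ∈ C.support := by
    have := hcon 0 (by have := hD.three_le_length; omega)
    rw [Walk.getVert_zero] at this
    exact Walk.mem_support_of_adj_toSubgraph this
  have hall : ∀ i, i ≤ (C.rotate b hbC).length → (C.rotate b hbC).getVert i ∈ D.support := by
    intro i
    induction i with
    | zero => intro _; rw [Walk.getVert_zero]; exact D.start_mem_support
    | succ i ih =>
      intro hi
      refine hcl _ _ (ih (by omega)) ?_
      rw [← Walk.toSubgraph_rotate C hbC]
      exact Walk.toSubgraph_adj_getVert _ (by omega)
  have hss : C.support.toFinset ⊆ D.support.toFinset := by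
    intro v hv
    rw [List.mem_toFinset] at *
    have hv' : v ∈ (C.rotate b hbC).support := by
      rw [← Walk.mem_verts_toSubgraph, Walk.toSubgraph_rotate, Walk.mem_verts_toSubgraph]
      exact hv
    obtain ⟨i, rfl, hi⟩ := Walk.mem_support_iff_exists_getVert.1 hv'
    exact hall i hi
  have := Finset.card_le_card hss
  rw [cycle_supp hC, cycle_supp hD] at this
  omega

/-- A closing edge of a shortest cycle together with the complementary path. -/
theorem cycle_complement {b : V} {D : G.Walk b b} (hD : D.IsCycle)
    (hmin : ∀ (a : V) (w : G.Walk a a), w.IsCycle → D.length ≤ w.length) {i : ℕ} (hi : i < D.length) :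
    ∃ P : G.Walk (D.getVert (i + 1)) (D.getVert i), P.IsPath ∧ P.length + 1 = D.length ∧
      s(D.getVert i, D.getVert (i + 1)) ∉ P.edges := by
  have hnd : D.edges.Nodup := hD.edges_nodup
  have hlen : D.edges.length = D.length := D.length_edges
  let P0 := (D.drop (i + 1)).append (D.take i)
  have hP0 : P0.length + 1 = D.length := by
    simp only [P0, Walk.length_append, Walk.drop_length, Walk.take_length]
    omega
  have he0 : s(D.getVert i, D.getVert (i + 1)) ∉ P0.edges := by
    rw [← Walk.getElem_edges (by omega)]
    simp only [P0, Walk.edges_append, Walk.edges_drop, Walk.edges_take, List.mem_append, not_or]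
    constructor
    · intro h
      obtain ⟨j, hj, e⟩ := List.mem_drop_iff_getElem.1 h
      have := (hnd.getElem_inj_iff).1 e
      omega
    · intro h
      obtain ⟨j, hj, e⟩ := List.mem_take_iff_getElem.1 h
      have := (hnd.getElem_inj_iff).1 e
      omega
  have he : s(D.getVert i, D.getVert (i + 1)) ∉ P0.bypass.edges :=
    fun h => he0 (Walk.edges_bypass_subset_edges _ h)
  refine ⟨P0.bypass, P0.bypass_isPath, ?_, he⟩
  have hcyc := (Walk.cons_isCycle_iff P0.bypass (D.adj_getVert_succ hi)).2 ⟨P0.bypass_isPath, he⟩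
  have := hmin _ _ hcyc
  rw [Walk.length_cons] at this
  have := P0.length_bypass_le_length
  omega

theorem adm_bound {a b : V} {C : G.Walk a a} (hC : C.IsCycle) {D : G.Walk b b}
    (hD : D.IsCycle) (hlt : D.length < C.length)
    (hmin : ∀ (a : V) (w : G.Walk a a), w.IsCycle → D.length ≤ w.length) :
    2 * D.length + C.length ≤ 2 * Fintype.card V + 2 := by
  obtain ⟨i, hi, hiC⟩ := cycle_edge_not_mem hC hD hlt
  obtain ⟨P, hP, hPl, heP⟩ := cycle_complement hD hmin hi
  have hadj := D.adj_getVert_succ hi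
  generalize D.getVert i = x at *
  generalize D.getVert (i + 1) = y at *
  have heC : s(x, y) ∉ C.edges := by
    rwa [← Walk.adj_toSubgraph_iff_mem_edges]
  have hinj := hP.getVert_injOn
  have count : ∀ I : Finset ℕ, (∀ k ∈ I, k ≤ P.length ∧ P.getVert k ∉ C.support) →
      C.length + I.card ≤ Fintype.card V := by
    intro I hI
    rw [← cycle_supp hC]
    have h1 : (I.image P.getVert).card = I.card := by
      apply Finset.card_image_of_injOn
      intro k hk l hl e
      exact hinj (hI k hk).1 (hI l hl).1 e
    rw [← h1, ← Finset.card_union_of_disjoint]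
    · exact Finset.card_le_univ _
    · rw [Finset.disjoint_right]
      intro v hv hv'
      obtain ⟨k, hk, rfl⟩ := Finset.mem_image.1 hv
      exact (hI k hk).2 (List.mem_toFinset.1 hv')
  by_cases hex : ∃ k, k ≤ P.length ∧ P.getVert k ∈ C.support
  swap
  · push Not at hex
    have := count (Finset.range (P.length + 1)) (fun k hk => by
      rw [Finset.mem_range] at hk
      exact ⟨by omega, hex k (by omega)⟩)
    rw [Finset.card_range] at this
    omega
  obtain ⟨i0, ⟨hi0, hi0C⟩, hi0min⟩ : ∃ i0, (i0 ≤ P.length ∧ P.getVert i0 ∈ C.support) ∧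
      ∀ k < i0, ¬ (k ≤ P.length ∧ P.getVert k ∈ C.support) := by
    classical
    exact ⟨Nat.find hex, Nat.find_spec hex, fun k hk => Nat.find_min hex hk⟩
  obtain ⟨j0, hj0, hj0C, hj0max⟩ : ∃ j0, j0 ≤ P.length ∧ P.getVert j0 ∈ C.support ∧
      ∀ k, j0 < k → k ≤ P.length → P.getVert k ∉ C.support := by
    classical
    refine ⟨Nat.findGreatest (fun k => P.getVert k ∈ C.support) P.length,
      Nat.findGreatest_le _,
      Nat.findGreatest_spec (P := fun k => P.getVert k ∈ C.support) hi0 hi0C, ?_⟩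
    intro k h1 h2
    exact Nat.findGreatest_is_greatest h1 h2
  have hij : i0 ≤ j0 := by
    by_contra h
    exact hi0min j0 (by omega) ⟨hj0, hj0C⟩
  have h1 := count (Finset.range i0 ∪ Finset.Ioc j0 P.length) (fun k hk => by
    rw [Finset.mem_union, Finset.mem_range, Finset.mem_Ioc] at hk
    rcases hk with hk | hk
    · exact ⟨by omega, fun h => hi0min k hk ⟨by omega, h⟩⟩
    · exact ⟨hk.2, hj0max k hk.1 hk.2⟩)
  rw [Finset.card_union_of_disjoint (by
    rw [Finset.disjoint_left]
    intro k h1 h2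
    rw [Finset.mem_range] at h1
    rw [Finset.mem_Ioc] at h2
    omega), Finset.card_range, Nat.card_Ioc] at h1
  obtain ⟨A, hA, hAl⟩ := cycle_arc C hi0C hj0C
  let W := ((P.take i0).append A).append (P.drop j0)
  have hWl : W.length = i0 + A.length + (P.length - j0) := by
    simp only [W, Walk.length_append, Walk.take_length, Walk.drop_length]
    omega
  have hWe : s(x, y) ∉ W.edges := by
    simp only [W, Walk.edges_append, Walk.edges_drop, Walk.edges_take, List.mem_append, not_or]
    exact ⟨⟨fun h => heP (List.mem_of_mem_take h), fun h => heC (hA h)⟩,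
      fun h => heP (List.mem_of_mem_drop h)⟩
  have hcyc := (Walk.cons_isCycle_iff W.bypass hadj).2
    ⟨W.bypass_isPath, fun h => hWe (Walk.edges_bypass_subset_edges _ h)⟩
  have h2 := hmin _ _ hcyc
  rw [Walk.length_cons] at h2
  have h3 := W.length_bypass_le_length
  omega

theorem adm_bound' {g c n : ℕ} (h3 : 3 ≤ g) (hgc : g < c) {G : SimpleGraph (Fin n)} (h : memGclass g c G) :
    2 * g + c ≤ 2 * n + 2 := by
  obtain ⟨hG, rfl, rfl⟩ := h
  have hac : ¬ G.IsAcyclic := by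
    intro h
    rw [← girth_eq_zero] at h
    omega
  obtain ⟨b, D, hD, hDl⟩ := exists_girth_eq_length.2 hac
  have hmem : circumference G ∈
      {m : ℕ | ∃ (a : Fin n) (w : G.Walk a a), w.IsCycle ∧ w.length = m} := by
    unfold circumference
    apply Nat.sSup_mem
    · exact ⟨D.length, b, D, hD, rfl⟩
    · refine ⟨circumference G, ?_⟩
      rintro m ⟨a, w, hw, rfl⟩
      exact length_le_circumference hw
  obtain ⟨a, C, hC, hCl⟩ := hmem
  have := adm_bound hC hD (by omega) (fun a w hw => hDl ▸ hw.girth_le_length)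
  rw [Fintype.card_fin] at this
  omega

theorem lower_graph {g c n : ℕ} (h3 : 3 ≤ g) (hcn : c ≤ n)
    (hadm : ∃ G : SimpleGraph (Fin n), memGclass g c G)
    (hyp : g = c ∨ (g < c ∧ (c : ℝ) - 1 + (g : ℝ) / 4 ≤ (n : ℝ))) :
    ∃ G : SimpleGraph (Fin n), memGclass g c G ∧ (c : ℝ) / 4 ≤ hypDelta G := by
  rcases hyp with rfl | ⟨hlt, hn⟩
  · exact model_eq h3 hcn
  · obtain ⟨G0, hG0⟩ := hadm
    have hb := adm_bound' h3 hlt hG0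
    have hn' : 4 * c + g ≤ 4 * n + 4 := by
      have : 4 * (c : ℝ) + g ≤ 4 * n + 4 := by linarith
      exact_mod_cast this
    obtain ⟨p, q, hg, hp, hpq, hq3, hqc, hq, hpn⟩ : ∃ p q, g = p + q ∧ 1 ≤ p ∧ p ≤ q ∧ q ≤ 3 * p ∧
        2 * q ≤ c ∧ 2 ≤ q ∧ c + p - 1 ≤ n := by
      refine ⟨max ((g + 3) / 4) ((2 * g - c + 1) / 2), g - max ((g + 3) / 4) ((2 * g - c + 1) / 2),
        ?_, ?_, ?_, ?_, ?_, ?_, ?_⟩ <;> omega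
    rw [hg]
    exact model_lt hp hpq hq3 hqc hq hpn

end MG6

/-- Lemma (t1): If `(g,c,n)` is v-admissible and either `g = c`, or `g < c` and
`n ≥ c - 1 + g/4`, then `B(g,c,n) = c/4`. -/
theorem Bgcn_eq_of_large (g c n : ℕ) (h3 : 3 ≤ g) (hgc : g ≤ c) (hcn : c ≤ n)
    (hadm : ∃ G : SimpleGraph (Fin n), memGclass g c G)
    (hyp : g = c ∨ (g < c ∧ (c : ℝ) - 1 + (g : ℝ) / 4 ≤ (n : ℝ))) :
    Bgcn g c n = (c : ℝ) / 4 := by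
  obtain ⟨G, hG, hGd⟩ := lower_graph h3 hcn hadm hyp
  have hub : ∀ d ∈ {d : ℝ | ∃ G : SimpleGraph (Fin n), memGclass g c G ∧ d = hypDelta G},
      d ≤ (c : ℝ) / 4 := by
    rintro d ⟨G, ⟨hG, -, hc⟩, rfl⟩
    exact hypDelta_le hG (h3.trans hgc) (fun a w hw => hc ▸ length_le_circumference hw)
  apply le_antisymm
  · exact Real.sSup_le hub (by positivity)
  · exact hGd.trans (le_csSup ⟨_, hub⟩ ⟨G, hG, rfl⟩)
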